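/- Let S be a carpet in S² whose peripheral circles form a family of uniform quasicircles, and let Γ be a path family in S² with mod_S(Γ) < ∞. Then an extremal mass distribution for mod_S(Γ) exists: there is an admissible mass distribution ρ with Σ_i ρ(C_i)² = mod_S(Γ), i.e., the infimum in the definition of mod_S(Γ) is attained. -/

import Mathlib

open Set Metric

noncomputable section

/-- Level-`n` approximation `Q_n` of the standard `1/p`-Sierpiński carpet in `ℂ ≅ ℝ²`:
`Q_0` is the closed unit square, and `Q_{n+1}` is the union of the images of `Q_n` under
the `p² - 1` contractions `z ↦ (z + i + j·√-1)/p` with `(i,j)` ranging over all non-middle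
positions; this is the usual subdivide-and-remove-middle-squares construction. -/
def carpetApprox (p : ℕ) : ℕ → Set ℂ
  | 0 => {z : ℂ | z.re ∈ Set.Icc (0:ℝ) 1 ∧ z.im ∈ Set.Icc (0:ℝ) 1}
  | n + 1 =>
      ⋃ (i : ℕ) (j : ℕ) (_ : i < p) (_ : j < p)
        (_ : ¬(i = (p - 1) / 2 ∧ j = (p - 1) / 2)),
        (fun z : ℂ => (z + (i : ℂ) + (j : ℂ) * Complex.I) / (p : ℂ)) '' carpetApprox p n

/-- The standard `1/p`-Sierpiński carpet `S_p ⊆ ℝ² ≅ ℂ`. -/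
def sierpinskiCarpet (p : ℕ) : Set ℂ := ⋂ n, carpetApprox p n

/-- `η : [0,∞) → [0,∞)` is a (self-)homeomorphism of `[0,∞)`: it is continuous, strictly
increasing on `[0,∞)`, fixes `0` and maps `[0,∞)` onto `[0,∞)`. -/
def IsQSControl (η : ℝ → ℝ) : Prop :=
  ContinuousOn η (Set.Ici 0) ∧ StrictMonoOn η (Set.Ici 0) ∧ η 0 = 0 ∧
    Set.SurjOn η (Set.Ici 0) (Set.Ici 0)

/-- A map `f` between metric spaces is quasisymmetric: for some homeomorphism
`η : [0,∞) → [0,∞)` one has `d(f u, f v) ≤ η(d(u,v)/d(u,w)) · d(f u, f w)` for all `u,v,w`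
with `u ≠ w`. -/
def IsQSMap {X Y : Type*} [MetricSpace X] [MetricSpace Y] (f : X → Y) : Prop :=
  ∃ η : ℝ → ℝ, IsQSControl η ∧
    ∀ u v w : X, u ≠ w → dist (f u) (f v) ≤ η (dist u v / dist u w) * dist (f u) (f w)

/-- The boundary of the axis-parallel closed square with lower-left corner `c` and
side length `l`. -/
def squareBoundary (c : ℂ) (l : ℝ) : Set ℂ :=
  {z : ℂ | max |z.re - (c.re + l / 2)| |z.im - (c.im + l / 2)| = l / 2}

/-- The outer square `O = ∂([0,1]×[0,1])`. -/
def outerSquare : Set ℂ := squareBoundary 0 1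

/-- The middle square `M = ∂([(p-1)/(2p),(p+1)/(2p)]²)`. -/
def middleSquare (p : ℕ) : Set ℂ :=
  squareBoundary ((((p : ℝ) - 1) / (2 * p) : ℝ) * (1 + Complex.I)) (1 / p)

end

open MeasureTheory Filter Topology
open scoped ENNReal

noncomputable section

/-- The unit sphere `S² = {x ∈ ℝ³ : |x| = 1}`, with the metric induced from `ℝ³`. -/
def Sphere2 : Set (EuclideanSpace ℝ (Fin 3)) := Metric.sphere 0 1

/-- The `2`-dimensional Hausdorff measure `σ` on `S²`. -/
def sphereMeasure : Measure ↥Sphere2 := μH[2]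

/-- A path in `S²`: a continuous map of a finite interval (of one of the four kinds
`[a,b]`, `[a,b)`, `(a,b]`, `(a,b)` with `a < b`) into `S²`. -/
structure SpherePath where
  /-- The parameter interval. -/
  I : Set ℝ
  /-- The parameter set is a finite interval. -/
  hI : ∃ a b : ℝ, a < b ∧
    (I = Set.Icc a b ∨ I = Set.Ico a b ∨ I = Set.Ioc a b ∨ I = Set.Ioo a b)
  /-- The parametrizing map. -/
  toFun : ℝ → ↥Sphere2
  /-- Continuity on the parameter interval. -/
  cont : ContinuousOn toFun I

/-- The image of a path. -/
def SpherePath.image (γ : SpherePath) : Set ↥Sphere2 := γ.toFun '' γ.I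

/-- A path is locally rectifiable if it has finite length (total variation) on every
compact subinterval of its parameter interval. -/
def SpherePath.LocRectifiable (γ : SpherePath) : Prop :=
  ∀ a b : ℝ, Set.Icc a b ⊆ γ.I → eVariationOn γ.toFun (Set.Icc a b) < ⊤

/-- The arclength integral `∫ ρ ds` of a density `ρ` over the restriction of the curve
`f` to `[a,b]`, computed via the arclength parametrization: if `s(t)` denotes the length
of `f|[a,t]` and `L` the length of `f|[a,b]`, this is `∫₀ᴸ ρ(f(t(u))) du` where
`t(u) = inf{t ∈ [a,b] : s(t) ≥ u}`. -/
def arcIntegralOn (ρ : ↥Sphere2 → ℝ≥0∞) (f : ℝ → ↥Sphere2) (a b : ℝ) : ℝ≥0∞ :=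
  ∫⁻ u in Set.Ico (0 : ℝ) (eVariationOn f (Set.Icc a b)).toReal,
    ρ (f (sInf {t | t ∈ Set.Icc a b ∧
      ENNReal.ofReal u ≤ eVariationOn f (Set.Icc a t)}))

/-- The arclength integral `∫_γ ρ ds` of a density `ρ` along a path `γ`, defined as the
supremum of the arclength integrals over all compact subintervals of the parameter
interval. -/
def SpherePath.lineIntegral (γ : SpherePath) (ρ : ↥Sphere2 → ℝ≥0∞) : ℝ≥0∞ :=
  ⨆ (a : ℝ) (b : ℝ) (_ : Set.Icc a b ⊆ γ.I), arcIntegralOn ρ γ.toFun a b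

/-- The conformal modulus `mod(Γ)` of a family of paths in `S²`: the infimum of
`∫ ρ² dσ` over all Borel densities `ρ : S² → [0,∞]` with `∫_γ ρ ds ≥ 1` for every
locally rectifiable `γ ∈ Γ`. -/
def conformalModulus (Γ : Set SpherePath) : ℝ≥0∞ :=
  ⨅ (ρ : ↥Sphere2 → ℝ≥0∞) (_ : Measurable ρ)
    (_ : ∀ γ ∈ Γ, γ.LocRectifiable → 1 ≤ γ.lineIntegral ρ),
    ∫⁻ x, ρ x ^ 2 ∂sphereMeasure

/-- A carpet in `S²`: a subset homeomorphic to the standard Sierpiński carpet `S_3`. -/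
def IsCarpet (S : Set ↥Sphere2) : Prop := Nonempty (↥S ≃ₜ ↥(sierpinskiCarpet 3))

/-- A peripheral circle of a carpet `S ⊆ S²`: a Jordan curve `C ⊆ S` (a subset
homeomorphic to a circle) whose complement `S ∖ C` in `S` is connected. -/
def IsPeripheralCircle (S C : Set ↥Sphere2) : Prop :=
  C ⊆ S ∧ Nonempty (↥C ≃ₜ ↥(Metric.sphere (0 : ℂ) 1)) ∧ IsConnected (S \ C)

/-- `Σ_{C : γ ∩ C ≠ ∅} ρ(C)`: the total mass of the peripheral circles of `S` met by the
path `γ`. -/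
def pathMassSum (S : Set ↥Sphere2) (ρ : Set ↥Sphere2 → ℝ≥0∞) (γ : SpherePath) : ℝ≥0∞ :=
  ∑' C : {C : Set ↥Sphere2 // IsPeripheralCircle S C ∧ (γ.image ∩ C).Nonempty}, ρ C

/-- A mass distribution `ρ` on the peripheral circles of `S` is admissible for the carpet
modulus `mod_S(Γ)` if there is an exceptional family `Γ₀ ⊆ Γ` of conformal modulus zero
such that every `γ ∈ Γ ∖ Γ₀` meets peripheral circles of total mass at least `1`. -/
def CarpetAdmissible (S : Set ↥Sphere2) (Γ : Set SpherePath)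
    (ρ : Set ↥Sphere2 → ℝ≥0∞) : Prop :=
  ∃ Γ₀ : Set SpherePath, Γ₀ ⊆ Γ ∧ conformalModulus Γ₀ = 0 ∧
    ∀ γ ∈ Γ \ Γ₀, 1 ≤ pathMassSum S ρ γ

/-- The total mass `Σ_i ρ(C_i)²` of a mass distribution on the peripheral circles of a
carpet `S`. -/
def carpetMass (S : Set ↥Sphere2) (ρ : Set ↥Sphere2 → ℝ≥0∞) : ℝ≥0∞ :=
  ∑' C : {C : Set ↥Sphere2 // IsPeripheralCircle S C}, ρ C ^ 2

/-- The carpet modulus `mod_S(Γ)` of a path family `Γ` with respect to a carpet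
`S ⊆ S²`. -/
def carpetModulus (S : Set ↥Sphere2) (Γ : Set SpherePath) : ℝ≥0∞ :=
  ⨅ (ρ : Set ↥Sphere2 → ℝ≥0∞) (_ : CarpetAdmissible S Γ ρ), carpetMass S ρ

/-- A family of Jordan curves in `S²` consists of uniform quasicircles if there is a
single control function `η` such that each curve in the family is the image of the
Euclidean unit circle under an `η`-quasisymmetric map. -/
def UniformQuasicircles (𝒞 : Set (Set ↥Sphere2)) : Prop :=
  ∃ η : ℝ → ℝ, IsQSControl η ∧ ∀ C ∈ 𝒞,
    ∃ f : ↥(Metric.sphere (0 : ℂ) 1) → ↥Sphere2, Set.range f = C ∧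
      Function.Injective f ∧
      ∀ u v w : ↥(Metric.sphere (0 : ℂ) 1), u ≠ w →
        dist (f u) (f v) ≤ η (dist u v / dist u w) * dist (f u) (f w)

end

/-! ### Logarithms and separation in the plane -/

theorem eq_of_exp_eq_one_of_isPreconnected {X : Type*} [TopologicalSpace X] {s : Set X}
    (hs : IsPreconnected s) {D : X → ℂ} (hD : ContinuousOn D s)
    (h1 : ∀ x ∈ s, Complex.exp (D x) = 1) {x y : X} (hx : x ∈ s) (hy : y ∈ s) : D x = D y := by
  have : DiscreteTopology (AddSubgroup.zmultiples (2 * Real.pi * Complex.I) : Set ℂ) :=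
    NormedSpace.discreteTopology_zmultiples _
  refine hs.constant_of_mapsTo (T := (AddSubgroup.zmultiples (2 * Real.pi * Complex.I) : Set ℂ))
    ⟨this⟩ hD ?_ hx hy
  intro z hz
  obtain ⟨n, hn⟩ := Complex.exp_eq_one_iff.1 (h1 z hz)
  exact AddSubgroup.mem_zmultiples_iff.2 ⟨n, by rw [hn]; simp⟩

theorem not_exists_log_on_sphere (a : ℂ) {R : ℝ} (hR : 0 < R) (L : ℂ → ℂ)
    (hL : ContinuousOn L (sphere a R)) (hexp : ∀ z ∈ sphere a R, Complex.exp (L z) = z - a) :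
    False := by
  have hmem : ∀ θ : ℝ, a + R * Complex.exp (θ * Complex.I) ∈ sphere a R := by
    intro θ
    simp [abs_of_pos hR, Complex.norm_exp_ofReal_mul_I]
  set g : ℝ → ℂ := fun θ ↦ L (a + R * Complex.exp (θ * Complex.I)) - θ * Complex.I with hg
  have hgc : Continuous g := by
    refine Continuous.sub ?_ (by fun_prop)
    exact hL.comp_continuous (by fun_prop) hmem
  have hexpg : ∀ θ, Complex.exp (g θ) = R := by
    intro θ
    have h0 := Complex.exp_ne_zero (θ * Complex.I)
    rw [hg, Complex.exp_sub, hexp _ (hmem θ)]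
    field_simp
    ring
  have key := eq_of_exp_eq_one_of_isPreconnected (isPreconnected_univ (α := ℝ))
    (D := fun θ ↦ g θ - g 0) (by fun_prop)
    (fun θ _ ↦ by
      rw [Complex.exp_sub, hexpg, hexpg, div_self (by exact_mod_cast hR.ne')])
    (mem_univ (2 * Real.pi)) (mem_univ 0)
  have h2 : Complex.exp ((2 * Real.pi : ℝ) * Complex.I) = 1 := by
    push_cast; exact Complex.exp_two_pi_mul_I
  simp only [hg, h2] at key
  simp [Real.pi_ne_zero] at key

theorem exists_log_of_homotopy {X : Type*} [TopologicalSpace X] (H : unitInterval × X → ℂ)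
    (hH : Continuous H) (h0 : ∀ a, H a ≠ 0) (h1 : ∀ x, H (0, x) = 1) :
    ∃ L : X → ℂ, Continuous L ∧ ∀ x, Complex.exp (L x) = H (1, x) := by
  let H' : C(unitInterval × X, {z : ℂ // z ≠ 0}) := ⟨fun a ↦ ⟨H a, h0 a⟩, by fun_prop⟩
  let f : C(X, ℂ) := ⟨fun _ ↦ 0, by fun_prop⟩
  have hH0 : ∀ x, H' (0, x) = (⟨_, (f x).exp_ne_zero⟩ : {z : ℂ // z ≠ 0}) := by
    intro x
    apply Subtype.ext
    simp [H', f, h1]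
  refine ⟨fun x ↦ Complex.isCoveringMap_exp.liftHomotopy H' f hH0 (1, x), by fun_prop, fun x ↦ ?_⟩
  have := congrFun (Complex.isCoveringMap_exp.liftHomotopy_lifts H' f hH0) (1, x)
  exact congrArg Subtype.val this

/-- A self-map of the plane that is the identity near infinity is surjective. -/
theorem false_of_continuous_of_eq_near_infty (R : ℂ → ℂ) (hR : Continuous R) (q : ℂ)
    (hq : ∀ z, R z ≠ q) (M : ℝ) (hM : ∀ z, M ≤ ‖z‖ → R z = z) : False := by
  have h0 : R 0 - q ≠ 0 := sub_ne_zero.2 (hq 0)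
  obtain ⟨L, hL, hexp⟩ := exists_log_of_homotopy
    (fun a : unitInterval × ℂ ↦ (R ((a.1 : ℝ) * a.2) - q) / (R 0 - q)) (by fun_prop)
    (fun a ↦ div_ne_zero (sub_ne_zero.2 (hq _)) h0) (fun x ↦ by simp [h0])
  refine not_exists_log_on_sphere q (R := |M| + ‖q‖ + 1) (by positivity)
    (fun z ↦ L z + Complex.log (R 0 - q)) (by fun_prop) ?_
  intro z hz
  rw [mem_sphere_iff_norm] at hz
  have hz' : M ≤ ‖z‖ := by
    have := norm_sub_le z q
    have := le_abs_self M
    linarith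
  rw [Complex.exp_add, hexp, Complex.exp_log h0]
  simp [hM z hz', h0]

theorem exists_log_compl_path (α : unitInterval → ℂ) (hα : Continuous α) :
    ∃ L : ℂ → ℂ, ContinuousOn L (range α)ᶜ ∧
      ∀ z ∉ range α, Complex.exp (L z) = (z - α 1) / (z - α 0) := by
  classical
  have hne : ∀ (z : ((range α)ᶜ : Set ℂ)) t, (z : ℂ) - α t ≠ 0 := by
    intro z t h
    exact z.2 ⟨t, (sub_eq_zero.1 h).symm⟩
  obtain ⟨L, hL, hexp⟩ := exists_log_of_homotopy
    (fun a : unitInterval × ((range α)ᶜ : Set ℂ) ↦ ((a.2 : ℂ) - α a.1) / (a.2 - α 0))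
    (Continuous.div (by fun_prop) (by fun_prop) (fun a ↦ hne _ _))
    (fun a ↦ div_ne_zero (hne _ _) (hne _ _)) (fun x ↦ div_self (hne _ _))
  refine ⟨fun z ↦ if h : z ∈ (range α)ᶜ then L ⟨z, h⟩ else 0, ?_, ?_⟩
  · rw [continuousOn_iff_continuous_domRestrict]
    convert hL using 1
    ext z
    simp only [domRestrict_apply, dif_pos z.2]
  · intro z hz
    have hz' : z ∈ (range α)ᶜ := hz
    simp only [dif_pos hz']
    exact hexp ⟨z, hz⟩

theorem exists_log_sub_near {a b : ℂ} (hab : a ≠ b) :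
    ∃ R > 0, (∀ z ∈ sphere a R, z ≠ a ∧ z ≠ b) ∧ ∃ K : ℂ → ℂ, ContinuousOn K (sphere a R) ∧
      ∀ z ∈ sphere a R, Complex.exp (K z) = z - b := by
  have hd : 0 < ‖a - b‖ := norm_pos_iff.2 (sub_ne_zero.2 hab)
  have hab' : a - b ≠ 0 := sub_ne_zero.2 hab
  have hball : ∀ z ∈ sphere a (‖a - b‖ / 2), 1 + (z - a) / (a - b) ∈ Complex.slitPlane := by
    intro z hz
    rw [mem_sphere_iff_norm] at hz
    apply Complex.mem_slitPlane_of_norm_lt_one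
    rw [norm_div, hz, div_lt_one hd]
    linarith
  have heq : ∀ z, z - b = (a - b) * (1 + (z - a) / (a - b)) := by
    intro z; field_simp; ring
  refine ⟨‖a - b‖ / 2, by positivity, ?_, fun z ↦ Complex.log (a - b) +
    Complex.log (1 + (z - a) / (a - b)), ?_, ?_⟩
  · intro z hz
    refine ⟨?_, ?_⟩
    · rintro rfl
      simp at hz
      linarith
    · rintro rfl
      rw [mem_sphere_iff_norm, norm_sub_rev] at hz
      linarith
  · refine ContinuousOn.add continuousOn_const (ContinuousOn.clog (by fun_prop) hball)
  · intro z hz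
    rw [Complex.exp_add, Complex.exp_log hab',
      Complex.exp_log (Complex.slitPlane_ne_zero (hball z hz)),
      ← heq]

/-- Two arcs with common endpoints that otherwise are disjoint separate the plane. -/
theorem not_isPreconnected_compl_of_two_paths (α β : unitInterval → ℂ) (hα : Continuous α)
    (hβ : Continuous β) {a b : ℂ} (hab : a ≠ b) (hα0 : α 0 = a) (hα1 : α 1 = b) (hβ0 : β 0 = a)
    (hβ1 : β 1 = b) (hInt : range α ∩ range β ⊆ {a, b}) :
    ¬ IsPreconnected (range α ∪ range β)ᶜ := by
  classical
  intro hconn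
  obtain ⟨LA, hLA, hA⟩ := exists_log_compl_path α hα
  obtain ⟨LB, hLB, hB⟩ := exists_log_compl_path β hβ
  rw [hα0, hα1] at hA
  rw [hβ0, hβ1] at hB
  have hoA : IsOpen (range α)ᶜ := (isCompact_range hα).isClosed.isOpen_compl
  have hoB : IsOpen (range β)ᶜ := (isCompact_range hβ).isClosed.isOpen_compl
  rw [compl_union] at hconn
  have hDc : ContinuousOn (fun z ↦ LA z - LB z) ((range α)ᶜ ∩ (range β)ᶜ) :=
    (hLA.mono inter_subset_left).sub (hLB.mono inter_subset_right)
  have ha : a ∈ range α := ⟨0, hα0⟩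
  have hb : b ∈ range α := ⟨1, hα1⟩
  have hne : ∀ z ∉ range α, z - b ≠ 0 ∧ z - a ≠ 0 := fun z hz ↦
    ⟨fun h ↦ hz (sub_eq_zero.1 h ▸ hb), fun h ↦ hz (sub_eq_zero.1 h ▸ ha)⟩
  have hD1 : ∀ z ∈ (range α)ᶜ ∩ (range β)ᶜ, Complex.exp (LA z - LB z) = 1 := by
    intro z hz
    rw [Complex.exp_sub, hA z hz.1, hB z hz.2,
      div_self (div_ne_zero (hne z hz.1).1 (hne z hz.1).2)]
  obtain ⟨c, hc1, hc⟩ : ∃ c : ℂ, Complex.exp c = 1 ∧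
      ∀ z ∈ (range α)ᶜ ∩ (range β)ᶜ, LA z = LB z + c := by
    by_cases hne : ((range α)ᶜ ∩ (range β)ᶜ).Nonempty
    · obtain ⟨w, hw⟩ := hne
      refine ⟨LA w - LB w, hD1 w hw, fun z hz ↦ ?_⟩
      have := eq_of_exp_eq_one_of_isPreconnected hconn hDc hD1 hz hw
      rw [← this]; ring
    · exact ⟨0, by simp, fun z hz ↦ (hne ⟨z, hz⟩).elim⟩
  set L : ℂ → ℂ := fun z ↦ if z ∈ range α then LB z + c else LA z with hL
  have hLB' : ∀ z ∈ (range β)ᶜ, L z = LB z + c := by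
    intro z hz
    simp only [hL]
    split_ifs with h
    · rfl
    · exact hc z ⟨h, hz⟩
  have hLA' : ∀ z ∈ (range α)ᶜ, L z = LA z := fun z hz ↦ if_neg hz
  have hLcont : ∀ z, z ≠ a → z ≠ b → ContinuousAt L z ∧
      Complex.exp (L z) = (z - b) / (z - a) := by
    intro z hza hzb
    by_cases h : z ∈ range α
    · have h' : z ∈ (range β)ᶜ := fun h' ↦ by
        rcases hInt ⟨h, h'⟩ with h | h
        · exact hza h
        · exact hzb h
      refine ⟨?_, ?_⟩
      · refine ((hLB.continuousAt (hoB.mem_nhds h')).add (continuousAt_const (y := c))).congr ?_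
        filter_upwards [hoB.mem_nhds h'] with y hy using (hLB' y hy).symm
      · rw [hLB' z h', Complex.exp_add, hc1, mul_one, hB z h']
    · refine ⟨?_, ?_⟩
      · refine (hLA.continuousAt (hoA.mem_nhds h)).congr ?_
        filter_upwards [hoA.mem_nhds h] with y hy using (hLA' y hy).symm
      · rw [hLA' z h, hA z h]
  obtain ⟨R, hR, hRne, K, hK, hKexp⟩ := exists_log_sub_near hab
  refine not_exists_log_on_sphere a hR (fun z ↦ K z - L z) ?_ ?_
  · refine hK.sub fun z hz ↦ ?_
    exact (hLcont z (hRne z hz).1 (hRne z hz).2).1.continuousWithinAt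
  · intro z hz
    have h1 : z - a ≠ 0 := sub_ne_zero.2 (hRne z hz).1
    have h2 : z - b ≠ 0 := sub_ne_zero.2 (hRne z hz).2
    rw [Complex.exp_sub, hKexp z hz, (hLcont z (hRne z hz).1 (hRne z hz).2).2]
    field_simp

theorem not_isPreconnected_compl_range_circle (f : sphere (0 : ℂ) 1 → ℂ) (hf : Continuous f)
    (hinj : Function.Injective f) : ¬ IsPreconnected (range f)ᶜ := by
  have hmem : ∀ θ : ℝ, Complex.exp (θ * Complex.I) ∈ sphere (0 : ℂ) 1 := fun θ ↦ by
    simp [Complex.norm_exp_ofReal_mul_I]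
  let E : ℝ → sphere (0 : ℂ) 1 := fun θ ↦ ⟨Complex.exp (θ * Complex.I), hmem θ⟩
  have hE : Continuous E := by fun_prop
  let α : unitInterval → ℂ := fun t ↦ f (E (Real.pi * t))
  let β : unitInterval → ℂ := fun t ↦ f (E (-(Real.pi * t)))
  have hE0 : E 0 = ⟨1, by simp⟩ := Subtype.ext (by simp [E])
  have hEpi : E Real.pi = ⟨-1, by simp⟩ := Subtype.ext (by simp [E])
  have hEnpi : E (-Real.pi) = ⟨-1, by simp⟩ := Subtype.ext (by simp [E, Complex.exp_neg])
  have hunion : range α ∪ range β = range f := by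
    apply Subset.antisymm
    · rintro _ (⟨t, rfl⟩ | ⟨t, rfl⟩) <;> exact mem_range_self _
    · rintro _ ⟨z, rfl⟩
      have hz : E (Complex.arg z) = z := by
        apply Subtype.ext
        have := Complex.norm_mul_exp_arg_mul_I (z : ℂ)
        have hn : ‖(z : ℂ)‖ = 1 := by simp
        simpa [hn, E] using this
      have hpi := Real.pi_pos
      rcases le_total 0 (Complex.arg z) with h | h
      · left
        refine ⟨⟨Complex.arg z / Real.pi, by positivity, ?_⟩, ?_⟩
        · rw [div_le_one hpi]; exact Complex.arg_le_pi _
        · simp only [α]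
          rw [mul_div_cancel₀ _ hpi.ne', hz]
      · right
        refine ⟨⟨-Complex.arg z / Real.pi, div_nonneg (by linarith) hpi.le, ?_⟩, ?_⟩
        · rw [div_le_one hpi]; linarith [Complex.neg_pi_lt_arg (z : ℂ)]
        · simp only [β]
          rw [mul_div_cancel₀ _ hpi.ne', neg_neg, hz]
  rw [← hunion]
  refine not_isPreconnected_compl_of_two_paths α β (by fun_prop) (by fun_prop)
    (a := f ⟨1, by simp⟩) (b := f ⟨-1, by simp⟩) ?_ ?_ ?_ ?_ ?_ ?_
  · intro h
    have := congrArg Subtype.val (hinj h)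
    norm_num at this
  · simp [α, hE0]
  · simp [α, hEpi]
  · simp [β, hE0]
  · simp [β, hEnpi]
  · rintro _ ⟨⟨t, rfl⟩, ⟨s, hs⟩⟩
    have h1 : E (-(Real.pi * s)) = E (Real.pi * t) := hinj hs
    have him := congrArg (fun z : sphere (0 : ℂ) 1 ↦ (z : ℂ).im) h1
    simp only [E, Complex.exp_ofReal_mul_I_im, Real.sin_neg] at him
    have hpi := Real.pi_pos
    have hs0 : 0 ≤ Real.sin (Real.pi * s) :=
      Real.sin_nonneg_of_nonneg_of_le_pi (mul_nonneg hpi.le s.2.1)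
        (mul_le_of_le_one_right hpi.le s.2.2)
    have ht0 : 0 ≤ Real.sin (Real.pi * t) :=
      Real.sin_nonneg_of_nonneg_of_le_pi (mul_nonneg hpi.le t.2.1)
        (mul_le_of_le_one_right hpi.le t.2.2)
    have hsin : Real.sin (Real.pi * t) = 0 := by linarith
    have hcos := Real.sin_sq_add_cos_sq (Real.pi * t)
    rw [hsin] at hcos
    have hcos' : Real.cos (Real.pi * t) = 1 ∨ Real.cos (Real.pi * t) = -1 :=
      by simpa using hcos
    have hval : ∀ c : ℝ, Real.cos (Real.pi * t) = c → (E (Real.pi * t) : ℂ) = c := by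
      intro c hc
      apply Complex.ext
      · simp only [E, Complex.exp_ofReal_mul_I_re, hc, Complex.ofReal_re]
      · simp only [E, Complex.exp_ofReal_mul_I_im, hsin, Complex.ofReal_im]
    rcases hcos' with h | h
    · left
      exact congrArg f (Subtype.ext (by simpa using hval _ h))
    · right
      exact congrArg f (Subtype.ext (by simpa using hval _ h))

theorem isPreconnected_norm_gt {M : ℝ} (hM : 0 < M) : IsPreconnected {z : ℂ | M < ‖z‖} := by
  have h : {z : ℂ | M < ‖z‖} = Complex.exp '' {z : ℂ | Real.log M < z.re} := by
    ext z
    constructor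
    · intro hz
      have hz : M < ‖z‖ := hz
      have hz0 : z ≠ 0 := norm_pos_iff.1 (hM.trans hz)
      exact ⟨Complex.log z, by simpa [Complex.log_re] using Real.log_lt_log hM hz,
        Complex.exp_log hz0⟩
    · rintro ⟨w, hw, rfl⟩
      simpa [Complex.norm_exp] using (Real.log_lt_iff_lt_exp hM).1 hw
  rw [h]
  exact (convex_halfSpace_re_gt _).isPreconnected.image _ Complex.continuous_exp.continuousOn

theorem frontier_connectedComponentIn_compl_subset {X : Type*} [TopologicalSpace X]
    [LocallyConnectedSpace X] {C : Set X} (hC : IsClosed C) (w : X) :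
    frontier (connectedComponentIn Cᶜ w) ⊆ C := by
  have ho := hC.isOpen_compl
  intro y hy
  by_contra hyC
  rw [ho.connectedComponentIn.frontier_eq] at hy
  obtain ⟨z, hz, hzw⟩ := mem_closure_iff.1 hy.1 _ (ho.connectedComponentIn (x := y))
    (mem_connectedComponentIn hyC)
  rw [connectedComponentIn_eq hzw, ← connectedComponentIn_eq hz] at hy
  exact hy.2 (mem_connectedComponentIn hyC)

/-- A Jordan curve in the plane has a bounded complementary component. -/
theorem exists_bounded_component_compl_circle (f : sphere (0 : ℂ) 1 → ℂ) (hf : Continuous f)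
    (hinj : Function.Injective f) :
    ∃ V : Set ℂ, V.Nonempty ∧ IsOpen V ∧ IsPreconnected V ∧ Bornology.IsBounded V ∧
      Disjoint V (range f) ∧ frontier V ⊆ range f := by
  have hC : IsClosed (range f) := (isCompact_range hf).isClosed
  obtain ⟨M, hM0, hM⟩ := (isCompact_range hf).isBounded.exists_pos_norm_le
  have hext : {z : ℂ | M < ‖z‖} ⊆ (range f)ᶜ := fun z hz hz' ↦ (hM z hz').not_gt hz
  have hz0 : ((M + 1 : ℝ) : ℂ) ∈ {z : ℂ | M < ‖z‖} := by
    rw [mem_ofPred_eq, Complex.norm_real, Real.norm_of_nonneg (by positivity)]; linarith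
  obtain ⟨w, hw, hw'⟩ : ∃ w ∈ (range f)ᶜ,
      w ∉ connectedComponentIn (range f)ᶜ ((M + 1 : ℝ) : ℂ) := by
    by_contra! h
    refine not_isPreconnected_compl_range_circle f hf hinj ?_
    rw [Subset.antisymm h (connectedComponentIn_subset _ _)]
    exact isPreconnected_connectedComponentIn
  refine ⟨connectedComponentIn (range f)ᶜ w, ⟨w, mem_connectedComponentIn hw⟩,
    hC.isOpen_compl.connectedComponentIn, isPreconnected_connectedComponentIn, ?_,
    disjoint_left.2 fun z hz ↦ connectedComponentIn_subset _ _ hz,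
    frontier_connectedComponentIn_compl_subset hC w⟩
  refine (isBounded_iff_forall_norm_le).2 ⟨M, fun z hz ↦ ?_⟩
  by_contra! hzM
  apply hw'
  have h1 := (isPreconnected_norm_gt hM0).subset_connectedComponentIn hz0 hext hzM
  rw [connectedComponentIn_eq h1, ← connectedComponentIn_eq hz]
  exact mem_connectedComponentIn hw

/-! ### Complementary domains of Jordan curves in the sphere -/

theorem exists_stereographic_chart (p : ↥Sphere2) :
    ∃ e : OpenPartialHomeomorph ↥Sphere2 ℂ, e.source = {p}ᶜ ∧ e.target = univ := by
  have : Fact (Module.finrank ℝ (EuclideanSpace ℝ (Fin 3)) = 2 + 1) := ⟨by simp⟩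
  let e₀ : OpenPartialHomeomorph ↥Sphere2 (EuclideanSpace ℝ (Fin 2)) := stereographic' 2 p
  refine ⟨e₀.transHomeomorph Complex.orthonormalBasisOneI.repr.symm.toHomeomorph, ?_, ?_⟩
  · exact stereographic'_source p
  · have : e₀.target = univ := stereographic'_target p
    simp [this]

theorem isCompact_sphere2 : IsCompact Sphere2 := isCompact_sphere 0 1

instance : CompactSpace ↥Sphere2 := isCompact_iff_compactSpace.1 isCompact_sphere2

theorem false_of_retraction_closure {V : Set ↥Sphere2} {p q : ↥Sphere2}
    (hp : p ∉ closure V) (hq : q ∈ V) (r : ↥Sphere2 → ↥Sphere2) (hr : ContinuousOn r (closure V))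
    (hid : ∀ y ∈ frontier V, r y = y) (hrp : ∀ y ∈ closure V, r y ≠ p ∧ r y ≠ q) : False := by
  classical
  obtain ⟨e, hsrc, htgt⟩ := exists_stereographic_chart p
  have hR' : Continuous (V.piecewise r id) :=
    continuous_piecewise hid hr continuousOn_id
  have hsymm : Continuous e.symm := by
    have := e.continuousOn_symm
    rwa [htgt, continuousOn_univ] at this
  have hsymm_mem : ∀ z, e.symm z ∈ e.source := fun z ↦ e.map_target (by simp [htgt])
  have hne : ∀ z, V.piecewise r id (e.symm z) ∈ e.source ∧ V.piecewise r id (e.symm z) ≠ q := by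
    intro z
    by_cases hz : e.symm z ∈ V
    · rw [piecewise_eq_of_mem _ _ _ hz, hsrc]
      exact hrp _ (subset_closure hz)
    · rw [piecewise_eq_of_notMem _ _ _ hz]
      exact ⟨hsymm_mem z, fun h ↦ hz (by rw [id] at h; rwa [h])⟩
  have hqs : q ∈ e.source := by
    rw [hsrc]
    rintro rfl
    exact hp (subset_closure hq)
  have hcs : closure V ⊆ e.source := fun y hy ↦ by
    rw [hsrc]
    rintro rfl
    exact hp hy
  have hcomp : IsCompact (e '' closure V) :=
    isClosed_closure.isCompact.image_of_continuousOn (e.continuousOn.mono hcs)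
  obtain ⟨M, -, hM⟩ := hcomp.isBounded.exists_pos_norm_lt
  refine false_of_continuous_of_eq_near_infty (fun z ↦ e (V.piecewise r id (e.symm z))) ?_ (e q)
    ?_ M ?_
  · exact e.continuousOn.comp_continuous (hR'.comp hsymm) fun z ↦ (hne z).1
  · intro z hz
    exact (hne z).2 (e.injOn (hne z).1 hqs hz)
  · intro z hz
    have : e.symm z ∉ V := fun h ↦ by
      have := hM _ ⟨_, subset_closure h, rfl⟩
      rw [e.right_inv (by simp [htgt])] at this
      exact this.not_ge hz
    simp only [piecewise_eq_of_notMem _ _ _ this, id]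
    exact e.right_inv (by simp [htgt])

/-- A Jordan curve in the sphere has a complementary component whose closure omits a given
point off the curve. -/
theorem exists_component_compl_circle (f : sphere (0 : ℂ) 1 → ↥Sphere2) (hf : Continuous f)
    (hinj : Function.Injective f) {p : ↥Sphere2} (hp : p ∉ range f) :
    ∃ V : Set ↥Sphere2, V.Nonempty ∧ IsOpen V ∧ IsPreconnected V ∧ Disjoint V (range f) ∧
      frontier V ⊆ range f ∧ p ∉ closure V := by
  obtain ⟨e, hsrc, htgt⟩ := exists_stereographic_chart p
  have hfs : ∀ z, f z ∈ e.source := fun z ↦ by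
    rw [hsrc]
    rintro h
    exact hp ⟨z, h⟩
  have hsymm : Continuous e.symm := by
    have := e.continuousOn_symm
    rwa [htgt, continuousOn_univ] at this
  have hopen : IsOpenEmbedding e.symm := e.symm.isOpenEmbedding (by simpa using htgt)
  obtain ⟨V, hne, ho, hconn, hb, hdisj, hfr⟩ := exists_bounded_component_compl_circle
    (fun z ↦ e (f z)) (e.continuousOn.comp_continuous hf hfs)
    (fun z w h ↦ hinj (e.injOn (hfs z) (hfs w) h))
  have hcl : closure (e.symm '' V) ⊆ e.symm '' closure V :=
    closure_minimal (image_mono subset_closure)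
      ((hb.isCompact_closure).image hsymm).isClosed
  refine ⟨e.symm '' V, hne.image _, hopen.isOpenMap _ ho, hconn.image _ hsymm.continuousOn,
    ?_, ?_, ?_⟩
  · rw [disjoint_left]
    rintro _ ⟨z, hz, rfl⟩ ⟨w, hw⟩
    refine disjoint_left.1 hdisj hz ⟨w, ?_⟩
    simp only [hw]
    exact e.right_inv (by simp [htgt])
  · intro y hy
    rw [(hopen.isOpenMap _ ho).frontier_eq] at hy
    obtain ⟨z, hz, rfl⟩ := hcl hy.1
    have hzV : z ∉ V := fun h ↦ hy.2 ⟨z, h, rfl⟩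
    obtain ⟨w, hw⟩ := hfr (show z ∈ frontier V by rw [ho.frontier_eq]; exact ⟨hz, hzV⟩)
    refine ⟨w, ?_⟩
    rw [← hw]
    exact (e.left_inv (hfs w)).symm
  · intro h
    obtain ⟨z, -, hz⟩ := hcl h
    have : e.symm z ∈ e.source := e.map_target (by simp [htgt])
    rw [hsrc, hz] at this
    exact this rfl

/-- A continuous zero-free function on the closure of a complementary domain of a Jordan curve
cannot have degree one on the boundary. -/
theorem false_of_degree_one {V : Set ↥Sphere2} (hne : V.Nonempty) {p : ↥Sphere2}
    (hp : p ∉ closure V) {f : sphere (0 : ℂ) 1 → ↥Sphere2} (hf : Continuous f)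
    (hinj : Function.Injective f) (hpf : p ∉ range f) (hdisj : Disjoint V (range f))
    (hfr : frontier V ⊆ range f) {ψ h : sphere (0 : ℂ) 1 → ℂ} (hψ : Continuous ψ)
    (hh : Continuous h) (hψ1 : ∀ v, ‖ψ v‖ = 1) (hψh : ∀ v, ψ v = v * Complex.exp (h v))
    {g : ↥Sphere2 → ℂ} (hg : Continuous g) (hg0 : ∀ y ∈ closure V, g y ≠ 0)
    (hgψ : ∀ v, f v ∈ frontier V → ‖g (f v) - ψ v‖ < 1) : False := by
  classical
  obtain ⟨q, hq⟩ := hne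
  have hemb : IsClosedEmbedding f := hf.isClosedEmbedding hinj
  let F := hemb.isEmbedding.toHomeomorph
  let k : frontier V → sphere (0 : ℂ) 1 := fun y ↦ F.symm ⟨y, hfr y.2⟩
  have hk : Continuous k := by fun_prop
  have hfk : ∀ y, f (k y) = y := fun y ↦ congrArg Subtype.val (F.apply_symm_apply ⟨y, hfr y.2⟩)
  have hψ0 : ∀ v, ψ v ≠ 0 := fun v hv ↦ by simpa [hv] using hψ1 v
  have hslit : ∀ y : frontier V, g y / ψ (k y) ∈ Complex.slitPlane := by
    intro y
    have h1 : g y / ψ (k y) = 1 + (g y - ψ (k y)) / ψ (k y) := by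
      field_simp [hψ0 (k y)]; ring
    rw [h1]
    apply Complex.mem_slitPlane_of_norm_lt_one
    rw [norm_div, hψ1, div_one]
    have := hgψ (k y) (by rw [hfk]; exact y.2)
    rwa [hfk] at this
  let h' : C(frontier V, ℂ) := ⟨fun y ↦ Complex.log (g y / ψ (k y)) + h (k y), by
    refine Continuous.add (Continuous.clog (Continuous.div (by fun_prop) (by fun_prop)
      fun y ↦ hψ0 _) hslit) (by fun_prop)⟩
  obtain ⟨H, hH⟩ := h'.exists_restrict_eq isClosed_frontier
  let N : ℂ → sphere (0 : ℂ) 1 := fun z ↦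
    if hz : z ≠ 0 then ⟨z / ‖z‖, by simp [hz]⟩ else ⟨1, by simp⟩
  have hN : ContinuousOn N {0}ᶜ := by
    rw [continuousOn_iff_continuous_domRestrict, continuous_induced_rng]
    have : (Subtype.val ∘ ({0}ᶜ : Set ℂ).domRestrict N) =
        fun z : ({0}ᶜ : Set ℂ) ↦ (z : ℂ) / ‖(z : ℂ)‖ := by
      ext1 z
      have hz : (z : ℂ) ≠ 0 := z.2
      simp [N, hz]
    rw [this]
    refine Continuous.div (by fun_prop) (by fun_prop) fun z ↦ ?_
    have hz : (z : ℂ) ≠ 0 := z.2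
    simpa using hz
  have hmem : ∀ y ∈ closure V, g y * Complex.exp (-H y) ∈ ({0}ᶜ : Set ℂ) := fun y hy ↦
    mul_ne_zero (hg0 y hy) (Complex.exp_ne_zero _)
  refine false_of_retraction_closure hp hq (fun y ↦ f (N (g y * Complex.exp (-H y)))) ?_ ?_ ?_
  · exact hf.comp_continuousOn (hN.comp (by fun_prop) hmem)
  · intro y hy
    have h1 : H y = h' ⟨y, hy⟩ := by rw [← hH]; rfl
    have h2 : g y * Complex.exp (-H y) = k ⟨y, hy⟩ := by
      have h3 := Complex.exp_log (Complex.slitPlane_ne_zero (hslit ⟨y, hy⟩))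
      have h4 := hψh (k ⟨y, hy⟩)
      have h5 := hψ0 (k ⟨y, hy⟩)
      have h6 := hg0 y (frontier_subset_closure hy)
      have h7 := Complex.exp_ne_zero (h (k ⟨y, hy⟩))
      rw [h1, Complex.exp_neg]
      simp only [h', ContinuousMap.coe_mk, Complex.exp_add, h3]
      field_simp
      rw [mul_comm]
      exact h4
    have hn : ‖((k ⟨y, hy⟩ : sphere (0 : ℂ) 1) : ℂ)‖ = 1 := by simp
    have h0 : ((k ⟨y, hy⟩ : sphere (0 : ℂ) 1) : ℂ) ≠ 0 := fun h ↦ by simp [h] at hn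
    have h3 : N (k ⟨y, hy⟩) = k ⟨y, hy⟩ := by
      apply Subtype.ext
      simp only [N, dif_pos h0, hn]
      simp
    simp only [h2, h3, hfk]
  · intro y hy
    exact ⟨fun h ↦ hpf ⟨_, h⟩, fun h ↦ disjoint_left.1 hdisj hq ⟨_, h⟩⟩

/-- Möbius self-maps of the unit circle expanding the arc of size `s` around `u`. -/
theorem exists_expanding_circle_map (u : sphere (0 : ℂ) 1) {s : ℝ} (hs : 0 < s) (hs2 : s ≤ 2) :
    ∃ ψ h : sphere (0 : ℂ) 1 → ℂ, Continuous ψ ∧ Continuous h ∧ (∀ v, ‖ψ v‖ = 1) ∧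
      (∀ v, ψ v = v * Complex.exp (h v)) ∧ (∀ v, s ≤ dist v u → ‖ψ v + 1‖ < 1 / 2) ∧
      ∀ v v', ‖ψ v - ψ v'‖ ≤ 32 / s * dist v v' := by
  set k : ℝ := s / 16 with hk
  have hk0 : 0 < k := by positivity
  set a : ℝ := 1 - k with ha
  have ha0 : 0 < a := by rw [ha, hk]; linarith
  have hun : ‖(u : ℂ)‖ = 1 := by simp
  have hu0 : (u : ℂ) ≠ 0 := fun h ↦ by simp [h] at hun
  let b : sphere (0 : ℂ) 1 → ℂ := fun v ↦ v / u
  have hb : Continuous b := by fun_prop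
  have hbn : ∀ v, ‖b v‖ = 1 := fun v ↦ by simp [b]
  let w : sphere (0 : ℂ) 1 → ℂ := fun v ↦ 1 - a * b v
  have hw : Continuous w := by fun_prop
  have hwre : ∀ v, k ≤ (w v).re := fun v ↦ by
    have h1 : (b v).re ≤ 1 := (Complex.re_le_norm _).trans (hbn v).le
    simp only [w, Complex.sub_re, Complex.one_re, Complex.re_ofReal_mul]
    nlinarith
  have hwk : ∀ v, k ≤ ‖w v‖ := fun v ↦ (hwre v).trans (Complex.re_le_norm _)
  have hwslit : ∀ v, w v ∈ Complex.slitPlane := fun v ↦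
    Complex.mem_slitPlane_iff.2 (Or.inl (hk0.trans_le (hwre v)))
  have hw0 : ∀ v, w v ≠ 0 := fun v ↦ Complex.slitPlane_ne_zero (hwslit v)
  have hcslit : ∀ v, (starRingEnd ℂ) (w v) ∈ Complex.slitPlane := fun v ↦
    Complex.mem_slitPlane_iff.2 (Or.inl (by simpa using hk0.trans_le (hwre v)))
  have hbw : ∀ v, b v * (starRingEnd ℂ) (w v) = b v - a := fun v ↦ by
    have : b v * (starRingEnd ℂ) (b v) = 1 := by
      rw [Complex.mul_conj, Complex.normSq_eq_norm_sq, hbn]; simp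
    simp only [w, map_sub, map_one, map_mul, Complex.conj_ofReal]
    linear_combination (-(a : ℂ)) * this
  refine ⟨fun v ↦ (b v - a) / w v,
    fun v ↦ Complex.log (w v |> starRingEnd ℂ) - Complex.log (w v) - Complex.log u, ?_, ?_, ?_, ?_,
    ?_, ?_⟩
  · exact Continuous.div (by fun_prop) hw hw0
  · exact ((Complex.continuous_conj.comp hw).clog hcslit).sub (hw.clog hwslit) |>.sub
      continuous_const
  · intro v
    simp only [← hbw, norm_div, norm_mul, hbn, one_mul, RCLike.norm_conj]
    exact div_self (norm_ne_zero_iff.2 (hw0 v))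
  · intro v
    simp only [Complex.exp_sub, Complex.exp_log (hw0 v), Complex.exp_log hu0,
      Complex.exp_log (Complex.slitPlane_ne_zero (hcslit v)), ← hbw]
    simp only [b]
    have := hw0 v
    field_simp
  · intro v hv
    have hd : dist v u = ‖b v - 1‖ := by
      have : b v - 1 = (v - u) / u := by simp only [b]; field_simp
      rw [this, norm_div, hun, div_one, Subtype.dist_eq, dist_eq_norm]
    have h1 : s - k ≤ ‖w v‖ := by
      have h2 : b v - 1 = -(w v) + k * b v := by simp only [w, ha]; push_cast; ring
      have h3 := norm_add_le (-(w v)) (k * b v)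
      rw [← h2, norm_neg, norm_mul, hbn, Complex.norm_real, Real.norm_of_nonneg hk0.le] at h3
      linarith
    have h4 : (b v - a) / w v + 1 = k * (1 + b v) / w v := by
      have := hw0 v
      field_simp
      simp only [w, ha]; push_cast; ring
    have h5 : ‖1 + b v‖ ≤ 2 := (norm_add_le _ _).trans (by rw [hbn]; norm_num)
    simp only [h4]
    rw [norm_div, norm_mul, Complex.norm_real, Real.norm_of_nonneg hk0.le,
      div_lt_iff₀ (norm_pos_iff.2 (hw0 v))]
    nlinarith
  · intro v v'
    have hd : dist v v' = ‖b v - b v'‖ := by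
      have : b v - b v' = (v - v') / u := by simp only [b]; field_simp
      rw [this, norm_div, hun, div_one, Subtype.dist_eq, dist_eq_norm]
    have h4 : (b v - a) / w v - (b v' - a) / w v' =
        ((1 - a ^ 2 : ℝ) : ℂ) * (b v - b v') / (w v * w v') := by
      have := hw0 v
      have := hw0 v'
      field_simp
      simp only [w]; push_cast; ring
    have ha1 : 0 ≤ 1 - a ^ 2 := by nlinarith
    simp only [h4]
    rw [norm_div, norm_mul, norm_mul, Complex.norm_real, Real.norm_of_nonneg ha1, hd,
      div_le_iff₀ (mul_pos (hk0.trans_le (hwk v)) (hk0.trans_le (hwk v')))]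
    have h5 : k ^ 2 ≤ ‖w v‖ * ‖w v'‖ := by
      rw [sq]
      exact mul_le_mul (hwk v) (hwk v') hk0.le (norm_nonneg _)
    have h6 : 32 / s = 2 / k := by rw [hk]; field_simp; norm_num
    have h7 : 1 - a ^ 2 ≤ 2 / k * (‖w v‖ * ‖w v'‖) := by
      have : 2 / k * k ^ 2 = 2 * k := by field_simp
      have h8 := mul_le_mul_of_nonneg_left h5 (show 0 ≤ 2 / k by positivity)
      have : 1 - a ^ 2 = 2 * k - k ^ 2 := by rw [ha]; ring
      nlinarith [sq_nonneg k]
    rw [h6]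
    calc (1 - a ^ 2) * ‖b v - b v'‖ ≤ 2 / k * (‖w v‖ * ‖w v'‖) * ‖b v - b v'‖ := by gcongr
      _ = _ := by ring

/-! ### Complementary domains of quasicircles are fat -/

theorem continuous_of_quasisymmetric {f : sphere (0 : ℂ) 1 → ↥Sphere2} {η : ℝ → ℝ}
    (hη : IsQSControl η)
    (hqs : ∀ u v w, u ≠ w → dist (f u) (f v) ≤ η (dist u v / dist u w) * dist (f u) (f w)) :
    Continuous f := by
  refine continuous_iff_continuousAt.2 fun u ↦ ?_
  have hne : u ≠ -u := fun h ↦ by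
    have h1 : (u : ℂ) = -u := congrArg Subtype.val h
    have h2 : (u : ℂ) = 0 := by linear_combination h1 / 2
    have h3 : ‖(u : ℂ)‖ = 1 := by simp
    simp [h2] at h3
  have h1 : Tendsto (fun v ↦ dist u v / dist u (-u)) (𝓝 u) (𝓝[Ici 0] 0) := by
    refine tendsto_nhdsWithin_iff.2 ⟨?_, Eventually.of_forall fun v ↦ ?_⟩
    · have : Continuous fun v ↦ dist u v / dist u (-u) := by fun_prop
      simpa using this.tendsto u
    · exact div_nonneg dist_nonneg dist_nonneg
  have h2 : Tendsto (fun v ↦ η (dist u v / dist u (-u)) * dist (f u) (f (-u))) (𝓝 u) (𝓝 0) := by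
    have h3 := ((hη.1 0 self_mem_Ici).tendsto.comp h1).mul_const (dist (f u) (f (-u)))
    rw [hη.2.2.1, zero_mul] at h3
    exact h3
  refine tendsto_iff_dist_tendsto_zero.2 (squeeze_zero (fun _ ↦ dist_nonneg) (fun v ↦ ?_) h2)
  rw [dist_comm]
  exact hqs u v _ hne

theorem connectedSpace_circle : ConnectedSpace (sphere (0 : ℂ) 1) :=
  isConnected_iff_connectedSpace.1 (isConnected_sphere (by simp) 0 zero_le_one)

/-- Quantitative form: the complementary domain `V` contains points at distance
comparable to `r` from the curve in every ball of radius `r` centered on the curve. -/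
theorem exists_fatness_constant {η : ℝ → ℝ} (hη : IsQSControl η) :
    ∃ ε : ℝ, 0 < ε ∧ ε ≤ 1 / 16 ∧ ∀ (f : sphere (0 : ℂ) 1 → ↥Sphere2), Function.Injective f →
      (∀ u v w, u ≠ w → dist (f u) (f v) ≤ η (dist u v / dist u w) * dist (f u) (f w)) →
      ∀ (V : Set ↥Sphere2) (p : ↥Sphere2), V.Nonempty → Disjoint V (range f) →
        frontier V ⊆ range f → p ∉ closure V → p ∉ range f → ∀ (u : sphere (0 : ℂ) 1) (r : ℝ),
        0 < r → r ≤ diam (range f) →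
        ∃ y ∈ V, dist y (f u) < r ∧ ε * r ≤ infDist y (range f) := by
  have hη1 : 0 < η 1 := by
    have := hη.2.1 self_mem_Ici (show (1 : ℝ) ∈ Ici 0 from mem_Ici.2 zero_le_one) zero_lt_one
    rwa [hη.2.2.1] at this
  have hη128 : 0 < η 128 := by
    have := hη.2.1 self_mem_Ici (show (128 : ℝ) ∈ Ici 0 by norm_num [mem_Ici]) (by norm_num)
    rwa [hη.2.2.1] at this
  have hmono : ∀ {x y : ℝ}, 0 ≤ x → x ≤ y → η x ≤ η y := fun hx hxy ↦
    hη.2.1.monotoneOn hx (hx.trans hxy) hxy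
  set ε : ℝ := min (1 / 16) (1 / (128 * η 1 * η 128)) with hε
  have hε0 : 0 < ε := by positivity
  have hε1 : ε ≤ 1 / 16 := min_le_left _ _
  have hε2 : ε * (128 * η 1 * η 128) ≤ 1 := by
    rw [← le_div_iff₀ (by positivity)]
    exact min_le_right _ _
  refine ⟨ε, hε0, hε1, ?_⟩
  intro f hinj hqs V p hVne hdisj hfr hp hpf u r hr hrd
  have hf := continuous_of_quasisymmetric hη hqs
  have := connectedSpace_circle
  have hη1' : 1 ≤ η 1 := by
    have hne : u ≠ -u := fun h ↦ by
      have h1 : (u : ℂ) = -u := congrArg Subtype.val h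
      have h2 : (u : ℂ) = 0 := by linear_combination h1 / 2
      have h3 : ‖(u : ℂ)‖ = 1 := by simp
      simp [h2] at h3
    have h1 := hqs u (-u) (-u) hne
    rw [div_self (dist_ne_zero.2 hne)] at h1
    have h2 : 0 < dist (f u) (f (-u)) := dist_pos.2 (hinj.ne hne)
    nlinarith
  set t : ℝ := r / (8 * η 1) with ht
  have ht0 : 0 < t := by positivity
  have htr : t ≤ r / 8 := by
    rw [ht, div_le_div_iff₀ (by positivity) (by norm_num)]
    nlinarith
  have htη : η 1 * t = r / 8 := by rw [ht]; field_simp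
  -- a point of the curve at distance exactly `t` from `f u`
  obtain ⟨v₀, hv₀⟩ : ∃ v₀, dist (f u) (f v₀) = t := by
    have h1 : ∃ v, t ≤ dist (f u) (f v) := by
      by_contra! h
      have h2 : diam (range f) ≤ 2 * t := by
        refine diam_le_of_forall_dist_le (by positivity) ?_
        rintro _ ⟨v, rfl⟩ _ ⟨w, rfl⟩
        have := dist_triangle_left (f v) (f w) (f u)
        linarith [h v, h w]
      linarith
    obtain ⟨v, hv⟩ := h1
    have h3 := isPreconnected_univ.intermediate_value (mem_univ u) (mem_univ v)
      (show Continuous fun v ↦ dist (f u) (f v) by fun_prop).continuousOn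
    obtain ⟨x, -, hx⟩ := h3 (show t ∈ Icc _ _ from ⟨by simpa using ht0.le, hv⟩)
    exact ⟨x, hx⟩
  have hne : u ≠ v₀ := by
    rintro rfl
    rw [dist_self] at hv₀
    exact ht0.ne hv₀
  set s := dist u v₀ with hs
  have hs0 : 0 < s := dist_pos.2 hne
  have hs2 : s ≤ 2 := by
    rw [hs, Subtype.dist_eq, dist_eq_norm]
    refine (norm_sub_le _ _).trans ?_
    simp
    norm_num
  obtain ⟨ψ, h, hψ, hh, hψ1, hψh, hfar, hlip⟩ := exists_expanding_circle_map u hs0 hs2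
  have hnear : ∀ v, dist v u ≤ s → dist (f u) (f v) ≤ r / 8 := by
    intro v hv
    have h1 := hqs u v v₀ hne
    rw [hv₀] at h1
    have h2 : η (dist u v / dist u v₀) ≤ η 1 :=
      hmono (by positivity) (div_le_one_of_le₀ (by rwa [dist_comm]) dist_nonneg)
    nlinarith
  have hfar' : ∀ v, r / 4 ≤ dist (f v) (f u) → ‖ψ v + 1‖ < 1 / 2 := by
    intro v hv
    refine hfar v (le_of_not_ge fun h1 ↦ ?_)
    have := hnear v h1
    rw [dist_comm] at this
    linarith
  -- points of the curve that are close have close images under `ψ`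
  have hclose' : ∀ v v', dist v u ≤ s → dist (f v) (f v') ≤ 4 * ε * r → ‖ψ v - ψ v'‖ < 1 := by
    intro v v' hvu hvv
    refine (hlip v v').trans_lt ?_
    rw [div_mul_eq_mul_div, div_lt_one hs0]
    by_contra! hlt
    have hvne : v ≠ v' := by
      rintro rfl
      rw [dist_self] at hlt
      linarith
    have hvpos : 0 < dist v v' := dist_pos.2 hvne
    have h1 : ∀ w, dist v w ≤ 2 * s → dist (f v) (f w) ≤ η 128 * (4 * ε * r) := by
      intro w hw
      have h2 := hqs v w v' hvne
      have h3 : η (dist v w / dist v v') ≤ η 128 :=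
        hmono (by positivity) (by rw [div_le_iff₀ hvpos]; linarith)
      exact h2.trans (mul_le_mul h3 hvv dist_nonneg hη128.le)
    have h4 := h1 u (by linarith)
    have h5 := h1 v₀ ((dist_triangle v u v₀).trans (by linarith))
    have h6 := dist_triangle_left (f u) (f v₀) (f v)
    rw [hv₀] at h6
    have h7 : t ≤ 8 * η 128 * ε * r := by linarith
    have h8 : η 1 * t ≤ η 1 * (8 * η 128 * ε * r) := mul_le_mul_of_nonneg_left h7 hη1.le
    rw [htη] at h8
    have h9 := mul_le_mul_of_nonneg_right hε2 hr.le
    linarith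
  have hclose : ∀ v v', dist (f v) (f v') ≤ 4 * ε * r → ‖ψ v - ψ v'‖ < 1 := by
    intro v v' hvv
    rcases le_total (dist v u) s with hv | hv
    · exact hclose' v v' hv hvv
    rcases le_total (dist v' u) s with hv' | hv'
    · rw [norm_sub_rev]
      exact hclose' v' v hv' (by rwa [dist_comm])
    · have h1 := norm_sub_le (ψ v + 1) (ψ v' + 1)
      rw [add_sub_add_right_eq_sub] at h1
      linarith [hfar v hv, hfar v' hv']
  by_contra! hcon
  have hcon' : ∀ y ∈ closure V, dist y (f u) < r → ∃ v, dist y (f v) < ε * r := by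
    intro y hy hyr
    by_cases hyV : y ∈ V
    · obtain ⟨_, ⟨v, rfl⟩, hv⟩ := (infDist_lt_iff (range_nonempty f)).1 (hcon y hyV hyr)
      exact ⟨v, hv⟩
    · obtain ⟨v, rfl⟩ := hfr ⟨hy, fun h ↦ hyV (interior_subset h)⟩
      exact ⟨v, by rw [dist_self]; positivity⟩
  let T : ↥Sphere2 → Set ℂ := fun y ↦ {z | y ∈ closure V →
    (∀ v, dist y (f v) < 2 * ε * r → z ∈ ball (ψ v) 1) ∧ (r / 2 ≤ dist y (f u) → z ∈ ball (-1) 1)}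
  have hT : ∀ y, Convex ℝ (T y) := by
    intro y z hz z' hz' a b ha hb hab hy
    exact ⟨fun v hv ↦ convex_ball _ _ ((hz hy).1 v hv) ((hz' hy).1 v hv) ha hb hab,
      fun hv ↦ convex_ball _ _ ((hz hy).2 hv) ((hz' hy).2 hv) ha hb hab⟩
  have hψfar : ∀ v, r / 4 ≤ dist (f v) (f u) → ψ v ∈ ball (-1 : ℂ) 1 := fun v hv ↦ by
    rw [mem_ball, dist_eq_norm, sub_neg_eq_add]
    linarith [hfar' v hv]
  have hεr : ε * r ≤ r / 16 := by nlinarith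
  have hεr0 : 0 < ε * r := by positivity
  have hlocal : ∀ y, ∃ c : ℂ, ∀ᶠ x in 𝓝 y, c ∈ T x := by
    intro y
    by_cases hy : y ∈ closure V
    swap
    · refine ⟨0, ?_⟩
      filter_upwards [isClosed_closure.isOpen_compl.mem_nhds hy] with x hx hx'
      exact absurd hx' hx
    rcases lt_or_ge (dist y (f u)) (3 / 4 * r) with hyr | hyr
    · obtain ⟨v₁, hv₁⟩ := hcon' y hy (by linarith)
      refine ⟨ψ v₁, ?_⟩
      filter_upwards [ball_mem_nhds y hεr0] with x hx _
      have hxv : dist x (f v₁) < 2 * ε * r := by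
        have := dist_triangle x y (f v₁)
        rw [mem_ball] at hx
        linarith
      refine ⟨fun v hv ↦ ?_, fun hxr ↦ hψfar _ ?_⟩
      · rw [mem_ball, dist_eq_norm]
        refine hclose _ _ ?_
        have := dist_triangle_left (f v₁) (f v) x
        linarith
      · have := dist_triangle x (f v₁) (f u)
        linarith
    · refine ⟨-1, ?_⟩
      filter_upwards [ball_mem_nhds y hεr0] with x hx _
      rw [mem_ball] at hx
      refine ⟨fun v hv ↦ ?_, fun _ ↦ mem_ball_self one_pos⟩
      rw [mem_ball_comm]
      refine hψfar v ?_
      have h1 := dist_triangle4 y x (f v) (f u)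
      rw [dist_comm y x] at h1
      linarith
  obtain ⟨g, hg⟩ := exists_continuous_forall_mem_convex_of_local_const hT hlocal
  refine false_of_degree_one hVne hp hf hinj hpf hdisj hfr hψ hh hψ1 hψh g.continuous ?_ ?_
  · intro y hy h0
    have h1 := hg y hy
    rw [h0] at h1
    rcases lt_or_ge (dist y (f u)) (r / 2) with hyr | hyr
    · obtain ⟨v, hv⟩ := hcon' y hy (by linarith)
      have h2 := h1.1 v (by linarith)
      rw [mem_ball, dist_eq_norm, zero_sub, norm_neg, hψ1] at h2
      exact lt_irrefl _ h2
    · have h2 := h1.2 hyr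
      simp at h2
  · intro v hv
    have h1 := (hg _ (frontier_subset_closure hv)).1 v (by rw [dist_self]; linarith)
    rwa [mem_ball, dist_eq_norm] at h1

/-! ### Geometry and measure of balls in the sphere -/

theorem norm_sphere2 (y : ↥Sphere2) : ‖(y : EuclideanSpace ℝ (Fin 3))‖ = 1 := by
  simpa [Sphere2] using y.2

theorem dist_sq_sphere2 (y z : ↥Sphere2) :
    dist y z ^ 2 = 2 - 2 * inner ℝ (y : EuclideanSpace ℝ (Fin 3)) z := by
  rw [Subtype.dist_eq, dist_eq_norm, norm_sub_sq_real, norm_sphere2, norm_sphere2]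
  ring

theorem dist_sphere2_le_two (y z : ↥Sphere2) : dist y z ≤ 2 := by
  rw [Subtype.dist_eq, dist_eq_norm]
  refine (norm_sub_le _ _).trans ?_
  rw [norm_sphere2, norm_sphere2]
  norm_num

/-- Radial projection to the sphere, with a dummy value at the origin. -/
noncomputable def radialProj (y : ↥Sphere2) (x : EuclideanSpace ℝ (Fin 3)) : ↥Sphere2 :=
  if hx : x = 0 then y else ⟨‖x‖⁻¹ • x, by simp [Sphere2, norm_smul, hx]⟩

theorem coe_radialProj (y : ↥Sphere2) {x : EuclideanSpace ℝ (Fin 3)} (hx : x ≠ 0) :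
    (radialProj y x : EuclideanSpace ℝ (Fin 3)) = ‖x‖⁻¹ • x := by
  simp [radialProj, hx]

theorem norm_normalize_sub_le {E : Type*} [NormedAddCommGroup E] [NormedSpace ℝ E] {a b : E}
    (ha : 1 ≤ ‖a‖) (hb : 1 ≤ ‖b‖) : ‖‖a‖⁻¹ • a - ‖b‖⁻¹ • b‖ ≤ 2 * ‖a - b‖ := by
  have ha0 : 0 < ‖a‖ := by linarith
  have hb0 : 0 < ‖b‖ := by linarith
  have h1 : ‖a‖⁻¹ • a - ‖b‖⁻¹ • b = ‖a‖⁻¹ • (a - b) + (‖a‖⁻¹ - ‖b‖⁻¹) • b := by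
    rw [smul_sub, sub_smul]; abel
  have h2 : (‖a‖⁻¹ - ‖b‖⁻¹) * ‖b‖ = ‖a‖⁻¹ * (‖b‖ - ‖a‖) := by field_simp
  have h3 : ‖a‖⁻¹ ≤ 1 := inv_le_one_of_one_le₀ ha
  have h4 : |‖b‖ - ‖a‖| ≤ ‖a - b‖ := by
    rw [norm_sub_rev]; exact abs_norm_sub_norm_le b a
  have h5 : 0 ≤ ‖a‖⁻¹ := by positivity
  calc _ ≤ ‖a‖⁻¹ * ‖a - b‖ + |(‖a‖⁻¹ - ‖b‖⁻¹) * ‖b‖| := by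
        rw [h1]
        refine (norm_add_le _ _).trans ?_
        rw [norm_smul, norm_smul, abs_mul, abs_norm, Real.norm_of_nonneg h5, Real.norm_eq_abs]
    _ ≤ 1 * ‖a - b‖ + 1 * ‖a - b‖ := by
        rw [h2, abs_mul, abs_of_nonneg h5]
        gcongr
    _ = _ := by ring

theorem isPreconnected_ball_sphere2 (y : ↥Sphere2) {r : ℝ} (hr : r ≤ 1) :
    IsPreconnected (ball y r) := by
  rcases le_or_gt r 0 with hr0 | hr0
  · rw [ball_eq_empty.2 hr0]; exact isPreconnected_empty
  refine isPreconnected_of_forall y fun z hz ↦ ?_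
  set c : ℝ := inner ℝ (y : EuclideanSpace ℝ (Fin 3)) z with hc
  have hc0 : 0 < c := by
    have h1 := dist_sq_sphere2 z y
    rw [mem_ball] at hz
    rw [real_inner_comm, ← hc] at h1
    nlinarith [dist_nonneg (x := z) (y := y)]
  have hc1 : c ≤ 1 := by
    have := real_inner_le_norm (y : EuclideanSpace ℝ (Fin 3)) z
    rwa [norm_sphere2, norm_sphere2, one_mul] at this
  let w : ℝ → EuclideanSpace ℝ (Fin 3) := fun t ↦ t • (y : EuclideanSpace ℝ (Fin 3)) + (1 - t) • z
  have hyy : inner ℝ (y : EuclideanSpace ℝ (Fin 3)) y = 1 := by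
    rw [real_inner_self_eq_norm_sq, norm_sphere2]; norm_num
  have hin : ∀ t, inner ℝ (y : EuclideanSpace ℝ (Fin 3)) (w t) = t + (1 - t) * c := fun t ↦ by
    simp only [w, inner_add_right, real_inner_smul_right, hyy, ← hc, mul_one]
  have hw0 : ∀ t ∈ Icc (0 : ℝ) 1, w t ≠ 0 := fun t ht h ↦ by
    have := hin t
    rw [h, inner_zero_right] at this
    nlinarith [ht.1, ht.2]
  have hw1 : ∀ t ∈ Icc (0 : ℝ) 1, ‖w t‖ ≤ 1 := fun t ht ↦ by
    refine (norm_add_le _ _).trans ?_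
    rw [norm_smul, norm_smul, norm_sphere2, norm_sphere2, Real.norm_of_nonneg ht.1,
      Real.norm_of_nonneg (by linarith [ht.2])]
    linarith
  refine ⟨(fun t ↦ radialProj y (w t)) '' Icc 0 1, ?_, ?_, ?_, ?_⟩
  · rintro _ ⟨t, ht, rfl⟩
    have h1 := dist_sq_sphere2 (radialProj y (w t)) y
    have h2 := dist_sq_sphere2 z y
    rw [real_inner_comm, coe_radialProj y (hw0 t ht), real_inner_smul_right, hin] at h1
    rw [real_inner_comm, ← hc] at h2
    have h3 : 1 ≤ ‖w t‖⁻¹ := (one_le_inv₀ (norm_pos_iff.2 (hw0 t ht))).2 (hw1 t ht)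
    have h4 : c ≤ t + (1 - t) * c := by nlinarith [ht.1]
    have h5 : c ≤ ‖w t‖⁻¹ * (t + (1 - t) * c) := by nlinarith
    rw [mem_ball] at hz ⊢
    refine lt_of_le_of_lt ?_ hz
    exact abs_le_of_sq_le_sq' (by linarith) dist_nonneg |>.2
  · refine ⟨1, by simp, ?_⟩
    apply Subtype.ext
    rw [coe_radialProj y (hw0 1 (by simp))]
    simp [w, norm_sphere2]
  · refine ⟨0, by simp, ?_⟩
    apply Subtype.ext
    rw [coe_radialProj y (hw0 0 (by simp))]
    simp [w, norm_sphere2]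
  · refine isPreconnected_Icc.image _ ?_
    have hwc : Continuous w := by fun_prop
    rw [continuousOn_iff_continuous_domRestrict, continuous_induced_rng]
    have : Subtype.val ∘ (Icc (0 : ℝ) 1).domRestrict (fun t ↦ radialProj y (w t)) =
        fun t : Icc (0 : ℝ) 1 ↦ ‖w t‖⁻¹ • w t := by
      ext1 t
      exact coe_radialProj y (hw0 t t.2)
    rw [this]
    have hwc' : Continuous fun t : Icc (0 : ℝ) 1 ↦ w t := by fun_prop
    exact (hwc'.norm.inv₀ fun t ↦ norm_ne_zero_iff.2 (hw0 t t.2)).smul hwc'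

theorem exists_tangent_isometry (y : ↥Sphere2) :
    ∃ ι : EuclideanSpace ℝ (Fin 2) →ₗᵢ[ℝ] EuclideanSpace ℝ (Fin 3),
      (∀ v, inner ℝ (y : EuclideanSpace ℝ (Fin 3)) (ι v) = 0) ∧
      ∀ z, inner ℝ (y : EuclideanSpace ℝ (Fin 3)) z = 0 → ∃ v, ι v = z := by
  have : Fact (Module.finrank ℝ (EuclideanSpace ℝ (Fin 3)) = 2 + 1) := ⟨by simp⟩
  have hy : (y : EuclideanSpace ℝ (Fin 3)) ≠ 0 := fun h ↦ by simpa [h] using norm_sphere2 y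
  let e := (OrthonormalBasis.fromOrthogonalSpanSingleton (𝕜 := ℝ) 2 hy).repr
  refine ⟨(Submodule.subtypeₗᵢ _).comp e.symm.toLinearIsometry, fun v ↦ ?_, fun z hz ↦ ?_⟩
  · exact Submodule.mem_orthogonal_singleton_iff_inner_right.1 (e.symm v).2
  · exact ⟨e ⟨z, Submodule.mem_orthogonal_singleton_iff_inner_right.2 hz⟩, by simp⟩

instance : (μH[2] : Measure (EuclideanSpace ℝ (Fin 2))).IsAddHaarMeasure := by
  have := MeasureTheory.isAddHaarMeasure_hausdorffMeasure (E := EuclideanSpace ℝ (Fin 2))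
  simpa using this

theorem le_sphereMeasure_ball (y : ↥Sphere2) {r : ℝ} (hr0 : 0 < r) (hr : r ≤ 1) :
    ENNReal.ofReal ((r / 2) ^ 2) * μH[2] (ball (0 : EuclideanSpace ℝ (Fin 2)) 1) ≤
      sphereMeasure (ball y r) := by
  obtain ⟨ι, hι, hι'⟩ := exists_tangent_isometry y
  have hyy : inner ℝ (y : EuclideanSpace ℝ (Fin 3)) y = 1 := by
    rw [real_inner_self_eq_norm_sq, norm_sphere2]; norm_num
  let P : ↥Sphere2 → EuclideanSpace ℝ (Fin 2) := fun z ↦ ι.toContinuousLinearMap.adjoint z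
  have hP : LipschitzWith 1 P := by
    refine LipschitzWith.of_dist_le_mul fun z w ↦ ?_
    simp only [P, dist_eq_norm, ← map_sub, Subtype.dist_eq]
    refine (ContinuousLinearMap.le_opNorm _ _).trans ?_
    gcongr
    rw [LinearIsometryEquiv.norm_map]
    exact ι.norm_toContinuousLinearMap_le
  have himg : ball (0 : EuclideanSpace ℝ (Fin 2)) (r / 2) ⊆ P '' ball y r := by
    intro v hv
    rw [mem_ball_zero_iff] at hv
    have hv1 : ‖v‖ ^ 2 ≤ 1 := by nlinarith [norm_nonneg v]
    set c := √(1 - ‖v‖ ^ 2) with hc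
    have hc2 : c ^ 2 = 1 - ‖v‖ ^ 2 := Real.sq_sqrt (by linarith)
    have hc0 : 0 ≤ c := Real.sqrt_nonneg _
    let z : ↥Sphere2 := ⟨ι v + c • (y : EuclideanSpace ℝ (Fin 3)), by
      simp only [Sphere2, mem_sphere_zero_iff_norm]
      have : ‖ι v + c • (y : EuclideanSpace ℝ (Fin 3))‖ ^ 2 = 1 := by
        rw [norm_add_sq_real, real_inner_smul_right, real_inner_comm, hι, norm_smul, norm_sphere2,
          ι.norm_map, Real.norm_of_nonneg hc0]
        linarith
      nlinarith [norm_nonneg (ι v + c • (y : EuclideanSpace ℝ (Fin 3)))]⟩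
    refine ⟨z, ?_, ?_⟩
    · have h1 := dist_sq_sphere2 z y
      have h2 : inner ℝ (z : EuclideanSpace ℝ (Fin 3)) y = c := by
        change inner ℝ (ι v + c • (y : EuclideanSpace ℝ (Fin 3))) y = c
        rw [real_inner_comm, inner_add_right, hι, real_inner_smul_right, hyy]
        ring
      rw [h2] at h1
      rw [mem_ball]
      have : c ^ 2 ≤ c := by nlinarith
      nlinarith [norm_nonneg v]
    · refine ext_inner_left ℝ fun w ↦ ?_
      simp only [P, z]
      rw [ContinuousLinearMap.adjoint_inner_right]
      simp only [LinearIsometry.coe_toContinuousLinearMap, inner_add_right, ι.inner_map_map,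
        real_inner_smul_right]
      rw [real_inner_comm (y : EuclideanSpace ℝ (Fin 3)), hι, mul_zero, add_zero]
  have h1 := hP.hausdorffMeasure_image_le (d := 2) (by norm_num) (ball y r)
  have h2 := Measure.addHaar_ball_of_pos (μH[2] : Measure (EuclideanSpace ℝ (Fin 2))) 0
    (half_pos hr0)
  simp only [finrank_euclideanSpace, Fintype.card_fin] at h2
  rw [← h2]
  refine (measure_mono himg).trans (h1.trans ?_)
  simp [sphereMeasure]

theorem sphereMeasure_closedBall_le (y : ↥Sphere2) {r : ℝ} (hr0 : 0 < r) (hr : r ≤ 1) :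
    sphereMeasure (closedBall y r) ≤
      4 * (ENNReal.ofReal ((2 * r) ^ 2) * μH[2] (ball (0 : EuclideanSpace ℝ (Fin 2)) 1)) := by
  obtain ⟨ι, hι, hι'⟩ := exists_tangent_isometry y
  have hyy : inner ℝ (y : EuclideanSpace ℝ (Fin 3)) y = 1 := by
    rw [real_inner_self_eq_norm_sq, norm_sphere2]; norm_num
  have hn : ∀ v, 1 ≤ ‖(y : EuclideanSpace ℝ (Fin 3)) + ι v‖ := fun v ↦ by
    have : ‖(y : EuclideanSpace ℝ (Fin 3)) + ι v‖ ^ 2 = 1 + ‖v‖ ^ 2 := by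
      rw [norm_add_sq_real, hι, norm_sphere2, ι.norm_map]; ring
    nlinarith [norm_nonneg ((y : EuclideanSpace ℝ (Fin 3)) + ι v), norm_nonneg v]
  have hn0 : ∀ v, (y : EuclideanSpace ℝ (Fin 3)) + ι v ≠ 0 := fun v ↦
    norm_pos_iff.1 (by linarith [hn v])
  let P : EuclideanSpace ℝ (Fin 2) → ↥Sphere2 := fun v ↦ radialProj y (y + ι v)
  have hP : LipschitzWith 2 P := by
    refine LipschitzWith.of_dist_le_mul fun v w ↦ ?_
    simp only [P, Subtype.dist_eq, dist_eq_norm, coe_radialProj y (hn0 _)]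
    refine (norm_normalize_sub_le (hn _) (hn _)).trans ?_
    rw [add_sub_add_left_eq_sub, ← map_sub, ι.norm_map]
    simp
  have himg : closedBall y r ⊆ P '' closedBall 0 (2 * r) := by
    intro z hz
    rw [mem_closedBall] at hz
    set c : ℝ := inner ℝ (y : EuclideanSpace ℝ (Fin 3)) z with hc
    have h1 := dist_sq_sphere2 z y
    rw [real_inner_comm, ← hc] at h1
    have hc0 : 1 / 2 ≤ c := by
      nlinarith [dist_nonneg (x := z) (y := y)]
    have hc1 : c ≤ 1 := by nlinarith
    have hcpos : 0 < c := by linarith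
    obtain ⟨v, hv⟩ := hι' (c⁻¹ • (z : EuclideanSpace ℝ (Fin 3)) - y) (by
      rw [inner_sub_right, real_inner_smul_right, hyy, ← hc, inv_mul_cancel₀ hcpos.ne', sub_self])
    refine ⟨v, ?_, ?_⟩
    · rw [mem_closedBall_zero_iff, ← ι.norm_map, hv]
      have h2 : ‖c⁻¹ • (z : EuclideanSpace ℝ (Fin 3)) - y‖ ^ 2 = c⁻¹ ^ 2 - 1 := by
        rw [norm_sub_sq_real, real_inner_smul_left, real_inner_comm, ← hc, norm_smul, norm_sphere2,
          norm_sphere2, Real.norm_of_nonneg (by positivity), inv_mul_cancel₀ hcpos.ne']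
        ring
      have h3 : c⁻¹ ^ 2 - 1 ≤ 4 * dist z y ^ 2 := by
        have h4 : c⁻¹ ^ 2 = 1 / c ^ 2 := by simp
        rw [h4, h1, sub_le_iff_le_add, div_le_iff₀ (by positivity)]
        nlinarith [mul_nonneg (sub_nonneg.2 hc1) (sub_nonneg.2 hc0),
          mul_nonneg (mul_nonneg (sub_nonneg.2 hc1) (sub_nonneg.2 hc0)) hcpos.le]
      have h5 : ‖c⁻¹ • (z : EuclideanSpace ℝ (Fin 3)) - y‖ ≤ 2 * dist z y := by
        refine abs_le_of_sq_le_sq' ?_ (by positivity) |>.2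
        rw [h2, mul_pow]
        linarith
      linarith
    · apply Subtype.ext
      simp only [P]
      rw [coe_radialProj y (hn0 _), hv, add_sub_cancel, norm_smul, norm_sphere2, mul_one,
        Real.norm_of_nonneg (by positivity), inv_inv, smul_smul, mul_inv_cancel₀ hcpos.ne',
        one_smul]
  have h1 := hP.hausdorffMeasure_image_le (d := 2) (by norm_num) (closedBall 0 (2 * r))
  have h2 := Measure.addHaar_closedBall (μH[2] : Measure (EuclideanSpace ℝ (Fin 2))) 0
    (show 0 ≤ 2 * r by positivity)
  simp only [finrank_euclideanSpace, Fintype.card_fin] at h2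
  rw [h2] at h1
  refine (measure_mono himg).trans (h1.trans_eq ?_)
  congr 1
  norm_num

instance : IsFiniteMeasure sphereMeasure := by
  refine ⟨isCompact_univ.measure_lt_top_of_nhdsWithin fun y _ ↦ ?_⟩
  refine ⟨closedBall y 1, mem_nhdsWithin_of_mem_nhds (closedBall_mem_nhds y one_pos), ?_⟩
  refine (sphereMeasure_closedBall_le y one_pos le_rfl).trans_lt ?_
  exact ENNReal.mul_lt_top (by simp) (ENNReal.mul_lt_top (by simp) measure_ball_lt_top)

/-- Two-dimensional Ahlfors regularity of the sphere. -/
theorem exists_ahlfors_constants : ∃ c K : ℝ, 0 < c ∧ 0 < K ∧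
    (∀ (y : ↥Sphere2) (r : ℝ), 0 < r → r ≤ 1 →
      ENNReal.ofReal (c * r ^ 2) ≤ sphereMeasure (ball y r)) ∧
    ∀ (y : ↥Sphere2) (r : ℝ), 0 < r →
      sphereMeasure (closedBall y r) ≤ ENNReal.ofReal (K * r ^ 2) := by
  set κ := (μH[2] (ball (0 : EuclideanSpace ℝ (Fin 2)) 1)).toReal with hκ
  have hκt : μH[2] (ball (0 : EuclideanSpace ℝ (Fin 2)) 1) ≠ ⊤ := measure_ball_lt_top.ne
  have hκ0 : 0 < κ := ENNReal.toReal_pos (measure_ball_pos _ _ one_pos).ne' hκt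
  have hκe : μH[2] (ball (0 : EuclideanSpace ℝ (Fin 2)) 1) = ENNReal.ofReal κ :=
    (ENNReal.ofReal_toReal hκt).symm
  set m := (sphereMeasure univ).toReal with hm
  have hm0 : 0 ≤ m := ENNReal.toReal_nonneg
  refine ⟨κ / 4, 16 * κ + m, by positivity, by positivity, fun y r hr0 hr ↦ ?_, fun y r hr0 ↦ ?_⟩
  · refine le_trans (le_of_eq ?_) (le_sphereMeasure_ball y hr0 hr)
    rw [hκe, ← ENNReal.ofReal_mul (by positivity)]
    congr 1
    ring
  · rcases le_total r 1 with hr | hr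
    · refine (sphereMeasure_closedBall_le y hr0 hr).trans ?_
      rw [hκe, ← ENNReal.ofReal_mul (by positivity), show (4 : ℝ≥0∞) = ENNReal.ofReal 4 by simp,
        ← ENNReal.ofReal_mul (by positivity)]
      refine ENNReal.ofReal_le_ofReal ?_
      nlinarith [mul_nonneg hm0 (sq_nonneg r)]
    · refine (measure_mono (subset_univ _)).trans ?_
      rw [← ENNReal.ofReal_toReal (measure_ne_top sphereMeasure univ), ← hm]
      refine ENNReal.ofReal_le_ofReal ?_
      have : 1 ≤ r ^ 2 := one_le_pow₀ hr
      nlinarith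

/-! ### Complementary domains of the peripheral circles -/

theorem IsPreconnected.subset_of_disjoint_frontier {X : Type*} [TopologicalSpace X] {A V : Set X}
    (hA : IsPreconnected A) (hV : IsOpen V) (hne : (A ∩ V).Nonempty)
    (hd : Disjoint A (frontier V)) : A ⊆ V := by
  refine hA.subset_left_of_subset_union hV isClosed_closure.isOpen_compl
    (disjoint_compl_right_iff_subset.2 subset_closure) (fun x hx ↦ ?_) hne
  by_cases hxc : x ∈ closure V
  · refine Or.inl (by_contra fun hxV ↦ disjoint_left.1 hd hx ?_)
    rw [hV.frontier_eq]
    exact ⟨hxc, hxV⟩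
  · exact Or.inr hxc

theorem diam_range_circle_pos {f : sphere (0 : ℂ) 1 → ↥Sphere2} (hinj : Function.Injective f) :
    0 < diam (range f) := by
  refine diam_pos ⟨f 1, ⟨1, rfl⟩, f (-1), ⟨-1, rfl⟩, hinj.ne fun h ↦ ?_⟩
    (isCompact_univ.isBounded.subset (subset_univ _))
  have h1 : (1 : ℂ) = -1 := congrArg Subtype.val h
  norm_num at h1

theorem exists_peripheral_domain {S : Set ↥Sphere2} {η : ℝ → ℝ} (hη : IsQSControl η) {ε : ℝ}
    (hε0 : 0 < ε) (hε1 : ε ≤ 1 / 16)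
    (hε : ∀ (f : sphere (0 : ℂ) 1 → ↥Sphere2), Function.Injective f →
      (∀ u v w, u ≠ w → dist (f u) (f v) ≤ η (dist u v / dist u w) * dist (f u) (f w)) →
      ∀ (V : Set ↥Sphere2) (p : ↥Sphere2), V.Nonempty → Disjoint V (range f) →
        frontier V ⊆ range f → p ∉ closure V → p ∉ range f → ∀ (u : sphere (0 : ℂ) 1) (r : ℝ),
        0 < r → r ≤ diam (range f) →
        ∃ y ∈ V, dist y (f u) < r ∧ ε * r ≤ infDist y (range f))
    {f : sphere (0 : ℂ) 1 → ↥Sphere2} (hinj : Function.Injective f)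
    (hqs : ∀ u v w, u ≠ w → dist (f u) (f v) ≤ η (dist u v / dist u w) * dist (f u) (f w))
    (hC : IsPeripheralCircle S (range f)) :
    ∃ V : Set ↥Sphere2, IsOpen V ∧ IsPreconnected V ∧ Disjoint V S ∧ frontier V = range f ∧
      ∀ x ∈ range f, ∀ r, 0 < r → r ≤ diam (range f) →
        ∃ y, ball y (ε * r) ⊆ V ∩ ball x (2 * r) := by
  obtain ⟨hCS, -, ⟨p, hpS, hpC⟩, hconn⟩ := hC
  have hf := continuous_of_quasisymmetric hη hqs
  obtain ⟨V, hne, ho, hpre, hdisj, hfr, hp⟩ := exists_component_compl_circle f hf hinj hpC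
  have hfat : ∀ x ∈ range f, ∀ r, 0 < r → r ≤ diam (range f) →
        ∃ y, ball y (ε * r) ⊆ V ∩ ball x (2 * r) := by
    rintro _ ⟨u, rfl⟩ r hr hrd
    obtain ⟨y, hyV, hyu, hy⟩ := hε f hinj hqs V p hne hdisj hfr hp hpC u r hr hrd
    have hr2 : r ≤ 2 := hrd.trans
      (diam_le_of_forall_dist_le zero_le_two fun x _ y _ ↦ dist_sphere2_le_two x y)
    refine ⟨y, subset_inter ?_ ?_⟩
    · refine (isPreconnected_ball_sphere2 y (by nlinarith)).subset_of_disjoint_frontier ho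
        ⟨y, mem_ball_self (by positivity), hyV⟩ (disjoint_left.2 fun z hz hzf ↦ ?_)
      have h1 := infDist_le_dist_of_mem (x := y) (hfr hzf)
      rw [mem_ball'] at hz
      linarith
    · intro z hz
      rw [mem_ball] at hz ⊢
      have := dist_triangle z y (f u)
      nlinarith
  refine ⟨V, ho, hpre, ?_, ?_, hfat⟩
  · rw [disjoint_left]
    intro s hsV hsS
    have h1 : S \ range f ⊆ V := hconn.subset_of_disjoint_frontier ho
      ⟨s, ⟨hsS, disjoint_left.1 hdisj hsV⟩, hsV⟩ (disjoint_left.2 fun z hz hzf ↦ hz.2 (hfr hzf))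
    exact hp (subset_closure (h1 ⟨hpS, hpC⟩))
  · refine hfr.antisymm fun x hx ↦ ?_
    rw [ho.frontier_eq]
    refine ⟨Metric.mem_closure_iff.2 fun δ hδ ↦ ?_, disjoint_right.1 hdisj hx⟩
    have hd0 := diam_range_circle_pos hinj
    have hr : 0 < min (δ / 2) (diam (range f)) := by positivity
    obtain ⟨y, hy⟩ := hfat x hx _ hr (min_le_right _ _)
    obtain ⟨hyV, hyx⟩ := hy (mem_ball_self (by positivity))
    refine ⟨y, hyV, ?_⟩
    rw [mem_ball, dist_comm] at hyx
    linarith [min_le_left (δ / 2) (diam (range f))]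

/-- The peripheral circles bound pairwise disjoint open sets of large area at every scale up to the
diameter. -/
theorem exists_fat_domains {S : Set ↥Sphere2}
    (hq : UniformQuasicircles {C | IsPeripheralCircle S C}) :
    ∃ (c : ℝ) (V : {C // IsPeripheralCircle S C} → Set ↥Sphere2), 0 < c ∧ (∀ C, IsOpen (V C)) ∧
      Pairwise (Function.onFun Disjoint V) ∧ (∀ C : {C // IsPeripheralCircle S C}, 0 < diam C.1) ∧
      ∀ C : {C // IsPeripheralCircle S C}, ∀ x ∈ C.1, ∀ r, 0 < r → r ≤ diam C.1 →
        ENNReal.ofReal (c * r ^ 2) ≤ sphereMeasure (V C ∩ ball x (2 * r)) := by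
  obtain ⟨η, hη, hC⟩ := hq
  obtain ⟨ε, hε0, hε1, hε⟩ := exists_fatness_constant hη
  obtain ⟨c, K, hc, hK, hlow, -⟩ := exists_ahlfors_constants
  have key : ∀ C : {C // IsPeripheralCircle S C}, ∃ V : Set ↥Sphere2, IsOpen V ∧
      IsPreconnected V ∧ Disjoint V S ∧ frontier V = C.1 ∧
      ∀ x ∈ C.1, ∀ r, 0 < r → r ≤ diam C.1 → ∃ y, ball y (ε * r) ⊆ V ∩ ball x (2 * r) := by
    rintro ⟨C, hC'⟩
    obtain ⟨f, rfl, hinj, hqs⟩ := hC C hC'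
    exact exists_peripheral_domain hη hε0 hε1 hε hinj hqs hC'
  choose V ho hpre hdS hfr hfat using key
  refine ⟨c * ε ^ 2, V, by positivity, ho, ?_, ?_, ?_⟩
  · have hsub : ∀ C C', (V C ∩ V C').Nonempty → V C ⊆ V C' := fun C C' hne ↦
      (hpre C).subset_of_disjoint_frontier (ho C') hne
        ((hdS C).mono_right ((hfr C').trans_subset C'.2.1))
    intro C C' hne
    by_contra hd
    rw [Function.onFun, not_disjoint_iff_nonempty_inter] at hd
    have h1 : V C = V C' := (hsub _ _ hd).antisymm (hsub _ _ (by rwa [inter_comm]))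
    apply hne
    apply Subtype.ext
    rw [← hfr, ← hfr, h1]
  · rintro ⟨C, hC'⟩
    obtain ⟨f, rfl, hinj, -⟩ := hC C hC'
    exact diam_range_circle_pos hinj
  · intro C x hx r hr hrd
    obtain ⟨y, hy⟩ := hfat C x hx r hr hrd
    have hr2 : r ≤ 2 := hrd.trans
      (diam_le_of_forall_dist_le zero_le_two fun x _ y _ ↦ dist_sphere2_le_two x y)
    refine le_trans ?_ (measure_mono hy)
    rw [mul_assoc, ← mul_pow]
    exact hlow y (ε * r) (by positivity) (by nlinarith)

/-! ### An `L²` bound for sums of indicators of dilated balls -/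

theorem ENNReal.mul_le_young {x y t : ℝ≥0∞} (ht0 : t ≠ 0) (ht : t ≠ ⊤) :
    x * y ≤ t * x ^ 2 + t⁻¹ * y ^ 2 := by
  rcases le_total y (t * x) with h | h
  · calc x * y ≤ x * (t * x) := by gcongr
      _ = t * x ^ 2 := by ring
      _ ≤ _ := le_self_add
  · calc x * y = t⁻¹ * (t * x) * y := by rw [← mul_assoc, ENNReal.inv_mul_cancel ht0 ht, one_mul]
      _ ≤ t⁻¹ * y * y := by gcongr
      _ = t⁻¹ * y ^ 2 := by ring
      _ ≤ _ := le_add_self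

theorem lintegral_sum_indicator_mul_sum_indicator {X ι : Type*} [MeasurableSpace X] (μ : Measure X)
    (F : Finset ι) (a : ι → ℝ≥0∞) {A B : ι → Set X} (hA : ∀ i, MeasurableSet (A i))
    (hB : ∀ i, MeasurableSet (B i)) :
    ∫⁻ y, (∑ i ∈ F, (A i).indicator (fun _ ↦ a i) y) * (∑ j ∈ F, (B j).indicator (fun _ ↦ a j) y) ∂μ
      = ∑ i ∈ F, ∑ j ∈ F, a i * a j * μ (A i ∩ B j) := by
  have h1 : ∀ y, (∑ i ∈ F, (A i).indicator (fun _ ↦ a i) y) *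
      (∑ j ∈ F, (B j).indicator (fun _ ↦ a j) y) =
      ∑ i ∈ F, ∑ j ∈ F, (A i ∩ B j).indicator (fun _ ↦ a i * a j) y := fun y ↦ by
    rw [Finset.sum_mul_sum]
    refine Finset.sum_congr rfl fun i _ ↦ Finset.sum_congr rfl fun j _ ↦ ?_
    rw [inter_indicator_mul]
  simp only [h1]
  rw [lintegral_finsetSum _ fun i _ ↦ Finset.measurable_fun_sum _ fun j _ ↦
    measurable_const.indicator ((hA i).inter (hB j))]
  refine Finset.sum_congr rfl fun i _ ↦ ?_
  rw [lintegral_finsetSum _ fun j _ ↦ measurable_const.indicator ((hA i).inter (hB j))]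
  refine Finset.sum_congr rfl fun j _ ↦ ?_
  rw [lintegral_indicator_const ((hA i).inter (hB j))]

theorem le_two_mul_of_le_add_half {w : ℕ → ℝ} {B M : ℝ} (hM : ∀ n, w n ≤ M)
    (h : ∀ n, w n ≤ B + w (n + 1) / 2) : w 0 ≤ 2 * B := by
  have hbdd : BddAbove (range w) := ⟨M, by rintro _ ⟨n, rfl⟩; exact hM n⟩
  have h1 : ⨆ n, w n ≤ B + (⨆ n, w n) / 2 :=
    ciSup_le fun n ↦ (h n).trans (by gcongr; exact le_ciSup hbdd _)
  linarith [le_ciSup hbdd 0]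

section

variable {ι : Type*} {x : ι → ↥Sphere2} {d : ι → ℝ} {E : ι → Set ↥Sphere2} {c K : ℝ}

theorem pair_measure_le (hc : 0 < c) (hd : ∀ i, 0 < d i)
    (hE : ∀ i, E i ⊆ closedBall (x i) (2 * d i))
    (hEc : ∀ i, ENNReal.ofReal (c * d i ^ 2) ≤ sphereMeasure (E i)) (hK : 0 < K)
    (hup : ∀ (y : ↥Sphere2) (r : ℝ), 0 < r →
      sphereMeasure (closedBall y r) ≤ ENNReal.ofReal (K * r ^ 2))
    {l : ℝ} (hl : 1 ≤ l) {i j : ι} (hij : d j ≤ d i) :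
    sphereMeasure (closedBall (x i) (l * d i) ∩ closedBall (x j) (l * d j)) ≤
      ENNReal.ofReal (K / c * l ^ 2) * sphereMeasure (closedBall (x i) (4 * l * d i) ∩ E j) := by
  rcases (closedBall (x i) (l * d i) ∩ closedBall (x j) (l * d j)).eq_empty_or_nonempty with h | h
  · simp [h]
  obtain ⟨z, hzi, hzj⟩ := h
  rw [mem_closedBall] at hzi hzj
  have hdi := hd i
  have hdj := hd j
  have hsub : E j ⊆ closedBall (x i) (4 * l * d i) := by
    intro y hy
    have h1 := hE j hy
    rw [mem_closedBall] at h1 ⊢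
    have h2 := dist_triangle4 y (x j) z (x i)
    rw [dist_comm (x j) z] at h2
    nlinarith
  rw [inter_eq_self_of_subset_right hsub]
  calc _ ≤ sphereMeasure (closedBall (x j) (l * d j)) := measure_mono inter_subset_right
    _ ≤ ENNReal.ofReal (K * (l * d j) ^ 2) := hup _ _ (by positivity)
    _ = ENNReal.ofReal (K / c * l ^ 2) * ENNReal.ofReal (c * d j ^ 2) := by
        rw [← ENNReal.ofReal_mul (by positivity)]
        congr 1
        field_simp
    _ ≤ _ := by gcongr; exact hEc j

theorem lintegral_sq_le_dilate (hc : 0 < c) (hd : ∀ i, 0 < d i) (hEm : ∀ i, MeasurableSet (E i))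
    (hE : ∀ i, E i ⊆ closedBall (x i) (2 * d i))
    (hEc : ∀ i, ENNReal.ofReal (c * d i ^ 2) ≤ sphereMeasure (E i)) (hK : 0 < K)
    (hup : ∀ (y : ↥Sphere2) (r : ℝ), 0 < r →
      sphereMeasure (closedBall y r) ≤ ENNReal.ofReal (K * r ^ 2))
    {l : ℝ} (hl : 1 ≤ l) (F : Finset ι) (a : ι → ℝ≥0∞) {t : ℝ} (ht : 0 < t) :
    ∫⁻ y, (∑ i ∈ F, (closedBall (x i) (l * d i)).indicator (fun _ ↦ a i) y) ^ 2 ∂sphereMeasure ≤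
      ENNReal.ofReal (2 * (K / c * l ^ 2)) *
        (ENNReal.ofReal t⁻¹ * ∫⁻ y, (∑ i ∈ F,
          (closedBall (x i) (4 * l * d i)).indicator (fun _ ↦ a i) y) ^ 2 ∂sphereMeasure +
        ENNReal.ofReal t * ∫⁻ y, (∑ i ∈ F, (E i).indicator (fun _ ↦ a i) y) ^ 2
          ∂sphereMeasure) := by
  have hcb : ∀ (l : ℝ) (i : ι), MeasurableSet (closedBall (x i) (l * d i)) := fun l i ↦
    measurableSet_closedBall
  set P := ENNReal.ofReal (K / c * l ^ 2) with hP
  set m : ι → ι → ℝ≥0∞ := fun i j ↦ a i * a j *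
    sphereMeasure (closedBall (x i) (4 * l * d i) ∩ E j) with hm
  have h1 : ∫⁻ y, (∑ i ∈ F, (closedBall (x i) (l * d i)).indicator (fun _ ↦ a i) y) ^ 2
      ∂sphereMeasure ≤ ∑ i ∈ F, ∑ j ∈ F, P * (m i j + m j i) := by
    simp only [sq]
    rw [lintegral_sum_indicator_mul_sum_indicator _ _ _ (hcb l) (hcb l)]
    refine Finset.sum_le_sum fun i _ ↦ Finset.sum_le_sum fun j _ ↦ ?_
    rcases le_total (d j) (d i) with hij | hij
    · calc _ ≤ a i * a j * (P * sphereMeasure (closedBall (x i) (4 * l * d i) ∩ E j)) := by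
            gcongr
            exact pair_measure_le hc hd hE hEc hK hup hl hij
        _ = P * m i j := by rw [hm]; ring
        _ ≤ _ := by gcongr; exact le_self_add
    · calc _ ≤ a i * a j * (P * sphereMeasure (closedBall (x j) (4 * l * d j) ∩ E i)) := by
            gcongr
            rw [inter_comm]
            exact pair_measure_le hc hd hE hEc hK hup hl hij
        _ = P * m j i := by rw [hm]; ring
        _ ≤ _ := by gcongr; exact le_add_self
  have h2 : ∑ i ∈ F, ∑ j ∈ F, P * (m i j + m j i) = 2 * P * ∑ i ∈ F, ∑ j ∈ F, m i j := by
    simp only [mul_add, Finset.sum_add_distrib]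
    rw [Finset.sum_comm (f := fun i j ↦ P * m j i)]
    simp only [← Finset.mul_sum]
    ring
  have h3 : ∑ i ∈ F, ∑ j ∈ F, m i j ≤ ENNReal.ofReal t⁻¹ * ∫⁻ y, (∑ i ∈ F,
          (closedBall (x i) (4 * l * d i)).indicator (fun _ ↦ a i) y) ^ 2 ∂sphereMeasure +
        ENNReal.ofReal t * ∫⁻ y, (∑ i ∈ F, (E i).indicator (fun _ ↦ a i) y) ^ 2 ∂sphereMeasure := by
    rw [hm, ← lintegral_sum_indicator_mul_sum_indicator _ _ _ (hcb (4 * l)) hEm,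
      ← lintegral_const_mul' _ _ ENNReal.ofReal_ne_top,
      ← lintegral_const_mul' _ _ ENNReal.ofReal_ne_top, ← lintegral_add_right _ (by fun_prop
        (disch := exact hEm _))]
    refine lintegral_mono fun y ↦ ?_
    have h4 := ENNReal.mul_le_young (t := ENNReal.ofReal t⁻¹)
      (x := ∑ i ∈ F, (closedBall (x i) (4 * l * d i)).indicator (fun _ ↦ a i) y)
      (y := ∑ i ∈ F, (E i).indicator (fun _ ↦ a i) y)
      (by simpa using ht) ENNReal.ofReal_ne_top
    rwa [← ENNReal.ofReal_inv_of_pos (by positivity), inv_inv] at h4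
  refine (h1.trans_eq h2).trans ?_
  rw [ENNReal.ofReal_mul zero_le_two, ← hP, ENNReal.ofReal_ofNat]
  gcongr

theorem lintegral_sum_indicator_ball_sq_le (hc : 0 < c) (hd : ∀ i, 0 < d i)
    (hEm : ∀ i, MeasurableSet (E i)) (hE : ∀ i, E i ⊆ closedBall (x i) (2 * d i))
    (hEc : ∀ i, ENNReal.ofReal (c * d i ^ 2) ≤ sphereMeasure (E i)) (hK : 0 < K)
    (hup : ∀ (y : ↥Sphere2) (r : ℝ), 0 < r →
      sphereMeasure (closedBall y r) ≤ ENNReal.ofReal (K * r ^ 2))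
    {l : ℝ} (hl : 1 ≤ l) (F : Finset ι) {a : ι → ℝ≥0∞} (ha : ∀ i, a i ≠ ⊤) :
    ∫⁻ y, (∑ i ∈ F, (closedBall (x i) (l * d i)).indicator (fun _ ↦ a i) y) ^ 2 ∂sphereMeasure ≤
      ENNReal.ofReal (1024 * (2 * (K / c * l ^ 2)) ^ 2) *
        ∫⁻ y, (∑ i ∈ F, (E i).indicator (fun _ ↦ a i) y) ^ 2 ∂sphereMeasure := by
  have hfin : ∀ A : ι → Set ↥Sphere2,
      ∫⁻ y, (∑ i ∈ F, (A i).indicator (fun _ ↦ a i) y) ^ 2 ∂sphereMeasure ≤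
        (∑ i ∈ F, a i) ^ 2 * sphereMeasure univ := fun A ↦ by
    rw [← lintegral_const]
    refine lintegral_mono fun y ↦ ?_
    gcongr with i
    exact indicator_le_self' (fun _ _ ↦ zero_le) y
  have htop : (∑ i ∈ F, a i) ^ 2 * sphereMeasure univ ≠ ⊤ :=
    ENNReal.mul_ne_top (ENNReal.pow_ne_top (ENNReal.sum_ne_top.2 fun i _ ↦ ha i))
      (measure_ne_top _ _)
  set P : ℝ := 2 * (K / c * l ^ 2) with hP
  have hP0 : 0 < P := by positivity
  set z : ℕ → ℝ≥0∞ := fun n ↦ ∫⁻ y, (∑ i ∈ F,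
    (closedBall (x i) (4 ^ n * l * d i)).indicator (fun _ ↦ a i) y) ^ 2 ∂sphereMeasure with hz
  have hzt : ∀ n, z n ≠ ⊤ := fun n ↦ ne_top_of_le_ne_top htop (hfin _)
  set G := ∫⁻ y, (∑ i ∈ F, (E i).indicator (fun _ ↦ a i) y) ^ 2 ∂sphereMeasure with hG
  have hGt : G ≠ ⊤ := ne_top_of_le_ne_top htop (hfin _)
  have hstep : ∀ n, (z n).toReal ≤ P * 16 ^ n *
      ((512 * P * 16 ^ n)⁻¹ * (z (n + 1)).toReal + 512 * P * 16 ^ n * G.toReal) := by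
    intro n
    have h1 := lintegral_sq_le_dilate hc hd hEm hE hEc hK hup
      (l := 4 ^ n * l) (one_le_mul_of_one_le_of_one_le (one_le_pow₀ (by norm_num)) hl) F a
      (t := 512 * P * 16 ^ n) (by positivity)
    have h2 : 2 * (K / c * (4 ^ n * l) ^ 2) = P * 16 ^ n := by
      rw [hP, mul_pow, ← pow_mul, mul_comm n 2, pow_mul]; norm_num; ring
    have h3 : 4 * (4 ^ n * l) = 4 ^ (n + 1) * l := by ring
    rw [h2, h3] at h1
    have h4 := ENNReal.toReal_mono (ENNReal.mul_ne_top ENNReal.ofReal_ne_top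
      (ENNReal.add_ne_top.2 ⟨ENNReal.mul_ne_top ENNReal.ofReal_ne_top (hzt (n + 1)),
        ENNReal.mul_ne_top ENNReal.ofReal_ne_top hGt⟩)) h1
    rwa [ENNReal.toReal_mul, ENNReal.toReal_add (ENNReal.mul_ne_top ENNReal.ofReal_ne_top
      (hzt (n + 1))) (ENNReal.mul_ne_top ENNReal.ofReal_ne_top hGt), ENNReal.toReal_mul,
      ENNReal.toReal_mul, ENNReal.toReal_ofReal (by positivity),
      ENNReal.toReal_ofReal (by positivity), ENNReal.toReal_ofReal (by positivity)] at h4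
  have h0 : (z 0).toReal ≤ 2 * (512 * P ^ 2 * G.toReal) := by
    have h1 := le_two_mul_of_le_add_half (w := fun n ↦ (z n).toReal / 256 ^ n)
      (B := 512 * P ^ 2 * G.toReal)
      (M := ((∑ i ∈ F, a i) ^ 2 * sphereMeasure univ).toReal) (fun n ↦ ?_) (fun n ↦ ?_)
    · simpa using h1
    · exact (div_le_self ENNReal.toReal_nonneg (one_le_pow₀ (by norm_num))).trans
        (ENNReal.toReal_mono htop (hfin _))
    · have h2 : (256 : ℝ) ^ n = 16 ^ n * 16 ^ n := by rw [← mul_pow]; norm_num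
      change (z n).toReal / 256 ^ n ≤ _ + (z (n + 1)).toReal / 256 ^ (n + 1) / 2
      rw [div_le_iff₀ (by positivity)]
      refine (hstep n).trans_eq ?_
      rw [pow_succ (256 : ℝ), h2]
      have h3 : (16 : ℝ) ^ n ≠ 0 := by positivity
      generalize (16 : ℝ) ^ n = q at h3 ⊢
      field_simp
      ring
  have hz0 : z 0 = ∫⁻ y, (∑ i ∈ F, (closedBall (x i) (l * d i)).indicator (fun _ ↦ a i) y) ^ 2
      ∂sphereMeasure := by simp [hz]
  rw [← hz0, ← ENNReal.ofReal_toReal (hzt 0), ← ENNReal.ofReal_toReal hGt,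
    ← ENNReal.ofReal_mul (by positivity)]
  exact ENNReal.ofReal_le_ofReal (by linarith)

/-- A substitute for Bojarski's lemma: the dilated balls carry at most a constant times the
`ℓ²`-norm of the coefficients. -/
theorem lintegral_tsum_indicator_ball_sq_le [Countable ι] (hc : 0 < c) (hd : ∀ i, 0 < d i)
    (hEm : ∀ i, MeasurableSet (E i)) (hdisj : Pairwise (Function.onFun Disjoint E))
    (hE : ∀ i, E i ⊆ closedBall (x i) (2 * d i))
    (hEc : ∀ i, ENNReal.ofReal (c * d i ^ 2) ≤ sphereMeasure (E i)) (hK : 0 < K)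
    (hup : ∀ (y : ↥Sphere2) (r : ℝ), 0 < r →
      sphereMeasure (closedBall y r) ≤ ENNReal.ofReal (K * r ^ 2))
    {l : ℝ} (hl : 1 ≤ l) {h : ι → ℝ≥0∞} (hh : ∀ i, h i ≠ ⊤) :
    ∫⁻ y, (∑' i, (closedBall (x i) (l * d i)).indicator
      (fun _ ↦ h i / ENNReal.ofReal (d i)) y) ^ 2 ∂sphereMeasure ≤
      ENNReal.ofReal (1024 * (2 * (K / c * l ^ 2)) ^ 2 * (4 * K)) * ∑' i, h i ^ 2 := by
  set a : ι → ℝ≥0∞ := fun i ↦ h i / ENNReal.ofReal (d i) with ha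
  have hd0 : ∀ i, ENNReal.ofReal (d i) ≠ 0 := fun i ↦ by simpa using hd i
  have hat : ∀ i, a i ≠ ⊤ := fun i ↦ ENNReal.div_ne_top (hh i) (hd0 i)
  have hfinite : ∀ F : Finset ι,
      ∫⁻ y, (∑ i ∈ F, (closedBall (x i) (l * d i)).indicator (fun _ ↦ a i) y) ^ 2 ∂sphereMeasure ≤
      ENNReal.ofReal (1024 * (2 * (K / c * l ^ 2)) ^ 2 * (4 * K)) * ∑' i, h i ^ 2 := by
    classical
    intro F
    refine (lintegral_sum_indicator_ball_sq_le hc hd hEm hE hEc hK hup hl F hat).trans ?_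
    rw [ENNReal.ofReal_mul (p := 1024 * (2 * (K / c * l ^ 2)) ^ 2) (by positivity), mul_assoc]
    gcongr
    simp only [sq]
    rw [lintegral_sum_indicator_mul_sum_indicator _ _ _ hEm hEm]
    calc _ ≤ ∑ i ∈ F, ENNReal.ofReal (4 * K) * h i ^ 2 := by
          refine Finset.sum_le_sum fun i hi ↦ ?_
          rw [Finset.sum_eq_single i]
          · rw [inter_self]
            have h1 : sphereMeasure (E i) ≤ ENNReal.ofReal (4 * K) * ENNReal.ofReal (d i) ^ 2 := by
              refine (measure_mono (hE i)).trans ((hup _ _ (by linarith [hd i])).trans_eq ?_)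
              rw [← ENNReal.ofReal_pow (hd i).le, ← ENNReal.ofReal_mul (by positivity)]
              congr 1
              ring
            calc a i * a i * sphereMeasure (E i)
                ≤ a i * a i * (ENNReal.ofReal (4 * K) * ENNReal.ofReal (d i) ^ 2) := by gcongr
              _ = ENNReal.ofReal (4 * K) * (a i * ENNReal.ofReal (d i)) ^ 2 := by ring
              _ = _ := by
                  rw [ha]
                  simp only
                  rw [ENNReal.div_mul_cancel (hd0 i) ENNReal.ofReal_ne_top]
          · intro j _ hji
            rw [(hdisj hji.symm).inter_eq, measure_empty, mul_zero]
          · exact fun h ↦ absurd hi h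
      _ = ENNReal.ofReal (4 * K) * ∑ i ∈ F, h i ^ 2 := by rw [Finset.mul_sum]
      _ ≤ _ := by
          gcongr
          simp only [← sq]
          exact ENNReal.sum_le_tsum F
  have hsup : ∀ y, (∑' i, (closedBall (x i) (l * d i)).indicator (fun _ ↦ a i) y) ^ 2 =
      ⨆ F : Finset ι, (∑ i ∈ F, (closedBall (x i) (l * d i)).indicator (fun _ ↦ a i) y) ^ 2 :=
    fun y ↦ by
      rw [ENNReal.tsum_eq_iSup_sum, ENNReal.iSup_pow]
  refine (lintegral_congr hsup).trans_le ?_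
  rw [lintegral_iSup_directed]
  · exact iSup_le hfinite
  · intro F
    exact ((Finset.measurable_fun_sum _ fun i _ ↦
      measurable_const.indicator measurableSet_closedBall).pow_const 2).aemeasurable
  · refine Monotone.directed_le fun F F' hF y ↦ ?_
    simp only
    gcongr

end

/-! ### Finiteness properties of the peripheral circles -/

section

variable {ι : Type*} {C : ι → Set ↥Sphere2} {V : ι → Set ↥Sphere2} {c : ℝ}

theorem finite_le_diam (hc : 0 < c) (hV : ∀ i, IsOpen (V i))
    (hdisj : Pairwise (Function.onFun Disjoint V)) (hne : ∀ i, (C i).Nonempty)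
    (hfat : ∀ i, ∀ x ∈ C i, ∀ r, 0 < r → r ≤ diam (C i) →
      ENNReal.ofReal (c * r ^ 2) ≤ sphereMeasure (V i ∩ ball x (2 * r)))
    {δ : ℝ} (hδ : 0 < δ) : {i | δ ≤ diam (C i)}.Finite := by
  refine (Measure.finite_const_le_meas_of_disjoint_iUnion sphereMeasure
    (ε := ENNReal.ofReal (c * δ ^ 2)) (by rw [ENNReal.ofReal_pos]; positivity)
    (fun i ↦ (hV i).measurableSet) hdisj (measure_ne_top _ _)).subset fun i hi ↦ ?_
  obtain ⟨x, hx⟩ := hne i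
  exact (hfat i x hx δ hδ hi).trans (measure_mono inter_subset_left)

theorem finite_mem_circle (hc : 0 < c) (hV : ∀ i, IsOpen (V i))
    (hdisj : Pairwise (Function.onFun Disjoint V)) (hd : ∀ i, 0 < diam (C i))
    (hfat : ∀ i, ∀ x ∈ C i, ∀ r, 0 < r → r ≤ diam (C i) →
      ENNReal.ofReal (c * r ^ 2) ≤ sphereMeasure (V i ∩ ball x (2 * r)))
    (y : ↥Sphere2) : {i | y ∈ C i}.Finite := by
  by_contra hinf
  obtain ⟨-, K, -, hK, -, hup⟩ := exists_ahlfors_constants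
  obtain ⟨n, hn⟩ := exists_nat_gt (4 * K / c)
  obtain ⟨F, hF, hcard⟩ := Set.Infinite.exists_subset_card_eq hinf n
  have hn0 : 0 < n := by
    have : (0 : ℝ) < n := lt_trans (by positivity) hn
    exact_mod_cast this
  have hFne : F.Nonempty := Finset.card_pos.1 (by omega)
  obtain ⟨i₀, hi₀, hmin⟩ := F.exists_min_image (fun i ↦ diam (C i)) hFne
  set r := diam (C i₀) with hr
  have hr0 : 0 < r := hd i₀
  have h1 : ∑ i ∈ F, sphereMeasure (V i ∩ ball y (2 * r)) ≤ ENNReal.ofReal (K * (2 * r) ^ 2) := by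
    rw [← measure_biUnion_finset]
    · refine le_trans (measure_mono ?_) (hup y (2 * r) (by positivity))
      exact iUnion₂_subset fun i _ ↦ inter_subset_right.trans ball_subset_closedBall
    · exact fun i _ j _ hij ↦ (hdisj hij).mono inter_subset_left inter_subset_left
    · exact fun i _ ↦ (hV i).measurableSet.inter measurableSet_ball
  have h2 : F.card • ENNReal.ofReal (c * r ^ 2) ≤ ∑ i ∈ F, sphereMeasure (V i ∩ ball y (2 * r)) :=
    Finset.card_nsmul_le_sum _ _ _ fun i hi ↦ hfat i y (hF hi) r hr0 (hmin i hi)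
  have h3 := h2.trans h1
  rw [hcard, nsmul_eq_mul, ← ENNReal.ofReal_natCast, ← ENNReal.ofReal_mul (by positivity),
    ENNReal.ofReal_le_ofReal_iff (by positivity)] at h3
  rw [div_lt_iff₀ hc] at hn
  nlinarith [sq_pos_of_pos hr0]

theorem countable_of_fat (hc : 0 < c) (hV : ∀ i, IsOpen (V i))
    (hdisj : Pairwise (Function.onFun Disjoint V)) (hne : ∀ i, (C i).Nonempty)
    (hd : ∀ i, 0 < diam (C i))
    (hfat : ∀ i, ∀ x ∈ C i, ∀ r, 0 < r → r ≤ diam (C i) →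
      ENNReal.ofReal (c * r ^ 2) ≤ sphereMeasure (V i ∩ ball x (2 * r))) : Countable ι := by
  rw [← countable_univ_iff]
  have : (univ : Set ι) = ⋃ n : ℕ, {i | 1 / ((n : ℝ) + 1) ≤ diam (C i)} := by
    refine (eq_univ_of_forall fun i ↦ ?_).symm
    obtain ⟨n, hn⟩ := exists_nat_one_div_lt (hd i)
    exact mem_iUnion.2 ⟨n, hn.le⟩
  rw [this]
  exact countable_iUnion fun n ↦
    (finite_le_diam hc hV hdisj hne hfat (by positivity)).countable

end

/-- The geometric input on the peripheral circles used for the carpet modulus. -/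
theorem exists_peripheral_geometry {S : Set ↥Sphere2}
    (hq : UniformQuasicircles {C | IsPeripheralCircle S C}) :
    ∃ (x : {C // IsPeripheralCircle S C} → ↥Sphere2) (M : ℝ≥0∞),
      Countable {C // IsPeripheralCircle S C} ∧ M ≠ ⊤ ∧
      (∀ C : {C // IsPeripheralCircle S C}, 0 < diam C.1 ∧ ∀ y ∈ C.1, dist y (x C) ≤ diam C.1) ∧
      (∀ δ : ℝ, 0 < δ → {C : {C // IsPeripheralCircle S C} | δ ≤ diam C.1}.Finite) ∧
      (∀ y, {C : {C // IsPeripheralCircle S C} | y ∈ C.1}.Finite) ∧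
      ∀ h : {C // IsPeripheralCircle S C} → ℝ≥0∞, (∀ C, h C ≠ ⊤) →
        ∫⁻ y, (∑' C, (closedBall (x C) (3 * diam C.1)).indicator
          (fun _ ↦ h C / ENNReal.ofReal (diam C.1)) y) ^ 2 ∂sphereMeasure ≤ M * ∑' C, h C ^ 2 := by
  obtain ⟨c, V, hc, hV, hdisj, hd, hfat⟩ := exists_fat_domains hq
  obtain ⟨-, K, -, hK, -, hup⟩ := exists_ahlfors_constants
  have hne : ∀ C : {C // IsPeripheralCircle S C}, C.1.Nonempty := fun C ↦
    nonempty_iff_ne_empty.2 fun h ↦ by simpa [h] using hd C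
  have hcount := countable_of_fat hc hV hdisj hne hd hfat
  choose x hx using hne
  refine ⟨x, ENNReal.ofReal (1024 * (2 * (K / c * 3 ^ 2)) ^ 2 * (4 * K)), hcount,
    ENNReal.ofReal_ne_top, fun C ↦ ⟨hd C, fun y hy ↦ dist_le_diam_of_mem
      (isCompact_univ.isBounded.subset (subset_univ _)) hy (hx C)⟩,
    fun δ hδ ↦ finite_le_diam hc hV hdisj (fun C ↦ ⟨x C, hx C⟩) hfat hδ,
    finite_mem_circle hc hV hdisj hd hfat, fun h hh ↦ ?_⟩
  refine lintegral_tsum_indicator_ball_sq_le (E := fun C ↦ V C ∩ ball (x C) (2 * diam C.1)) hc hd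
    (fun C ↦ (hV C).measurableSet.inter measurableSet_ball)
    (fun C C' hCC ↦ (hdisj hCC).mono inter_subset_left inter_subset_left)
    (fun C ↦ inter_subset_right.trans ball_subset_closedBall)
    (fun C ↦ hfat C _ (hx C) _ (hd C) le_rfl) hK hup (by norm_num) hh

/-! ### Arclength integrals of indicator functions of balls -/

theorem le_arcIntegralOn_indicator_ball {f : ℝ → ↥Sphere2} {a b t₃ t₄ D : ℝ}
    (hf : ContinuousOn f (Icc a b)) (hvar : eVariationOn f (Icc a b) < ⊤) (h₃ : a ≤ t₃)
    (h₃₄ : t₃ ≤ t₄) (h₄ : t₄ ≤ b) (hD : D ≤ dist (f t₃) (f t₄)) (m : ℝ≥0∞) :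
    m * ENNReal.ofReal D ≤ arcIntegralOn ((ball (f t₃) D).indicator fun _ ↦ m) f a b := by
  set s : ℝ → ℝ≥0∞ := fun t ↦ eVariationOn f (Icc a t) with hs
  have hsmono : ∀ {t t'}, t ≤ t' → s t ≤ s t' := fun h ↦
    eVariationOn.mono _ (Icc_subset_Icc_right h)
  have hsfin : ∀ {t}, t ≤ b → s t ≠ ⊤ := fun h ↦ ((hsmono h).trans_lt hvar).ne
  have hsadd : ∀ {t}, t₃ ≤ t → s t₃ + edist (f t₃) (f t) ≤ s t := fun {t} h ↦ by
    have hadd : s t₃ + eVariationOn f (Icc t₃ t) = s t := by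
      simpa only [univ_inter] using eVariationOn.Icc_add_Icc f (s := univ) h₃ h (mem_univ t₃)
    rw [← hadd]
    gcongr
    exact eVariationOn.edist_le f (left_mem_Icc.2 h) (right_mem_Icc.2 h)
  set u₀ := (s t₃).toReal with hu₀
  have hdist : ∀ {t}, t₃ ≤ t → t ≤ b → u₀ + dist (f t₃) (f t) ≤ (s t).toReal := fun h hb ↦ by
    have := ENNReal.toReal_mono (hsfin hb) (hsadd h)
    rwa [ENNReal.toReal_add (hsfin (h.trans hb)) (edist_ne_top _ _), ← dist_edist] at this
  have hsub : Ioo u₀ (u₀ + D) ⊆ Ico 0 (eVariationOn f (Icc a b)).toReal := fun u hu ↦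
    ⟨ENNReal.toReal_nonneg.trans hu.1.le, hu.2.trans_le (((add_le_add_right hD _).trans
      (hdist h₃₄ h₄)).trans (ENNReal.toReal_mono hvar.ne (hsmono h₄)))⟩
  have hmem : ∀ u ∈ Ioo u₀ (u₀ + D), f (sInf {t | t ∈ Icc a b ∧
      ENNReal.ofReal u ≤ eVariationOn f (Icc a t)}) ∈ ball (f t₃) D := by
    intro u hu
    set T : Set ℝ := {t | t ∈ Icc a b ∧ ENNReal.ofReal u ≤ eVariationOn f (Icc a t)}
    have hlow : ∀ t ∈ T, t₃ ≤ t := fun t ht ↦ by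
      by_contra! hlt
      have := ENNReal.ofReal_le_iff_le_toReal (hsfin (h₃₄.trans h₄)) |>.1
        (ht.2.trans (hsmono hlt.le))
      exact this.not_gt hu.1
    have h₄T : t₄ ∈ T := ⟨⟨h₃.trans h₃₄, h₄⟩, (ENNReal.ofReal_le_iff_le_toReal (hsfin h₄)).2
      (hu.2.le.trans ((add_le_add_right hD _).trans (hdist h₃₄ h₄)))⟩
    have hτ₃ : t₃ ≤ sInf T := le_csInf ⟨_, h₄T⟩ hlow
    have hτb : sInf T ≤ b := (csInf_le ⟨t₃, hlow⟩ h₄T).trans h₄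
    have hbelow : ∀ t ∈ Ico t₃ (sInf T), dist (f t) (f t₃) ≤ u - u₀ := fun t ht ↦ by
      have htT : t ∉ T := fun h ↦ ht.2.not_ge (csInf_le ⟨t₃, hlow⟩ h)
      have htb := ht.2.le.trans hτb
      have hlt : (s t).toReal < u := by
        by_contra! hle
        exact htT ⟨⟨h₃.trans ht.1, htb⟩, (ENNReal.ofReal_le_iff_le_toReal (hsfin htb)).2 hle⟩
      rw [dist_comm]
      linarith [hdist ht.1 htb]
    rw [mem_ball]
    refine lt_of_le_of_lt ?_ (sub_lt_iff_lt_add'.2 hu.2)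
    rcases hτ₃.eq_or_lt with heq | hlt
    · rw [← heq, dist_self]
      exact sub_nonneg.2 hu.1.le
    · have hcl : sInf T ∈ closure (Ico t₃ (sInf T)) := by
        rw [closure_Ico hlt.ne]
        exact right_mem_Icc.2 hτ₃
      have hcont : ContinuousWithinAt f (Ico t₃ (sInf T)) (sInf T) :=
        (hf _ ⟨h₃.trans hτ₃, hτb⟩).mono fun t ht ↦ ⟨h₃.trans ht.1, ht.2.le.trans hτb⟩
      exact ContinuousWithinAt.closure_le hcl (hcont.dist continuousWithinAt_const)
        continuousWithinAt_const hbelow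
  calc m * ENNReal.ofReal D = ∫⁻ u in Ioo u₀ (u₀ + D), m := by
        rw [setLIntegral_const, Real.volume_Ioo, add_sub_cancel_left]
    _ ≤ ∫⁻ u in Ioo u₀ (u₀ + D), (ball (f t₃) D).indicator (fun _ ↦ m) (f (sInf {t | t ∈ Icc a b ∧
          ENNReal.ofReal u ≤ eVariationOn f (Icc a t)})) := by
        refine setLIntegral_mono' measurableSet_Ioo fun u hu ↦ ?_
        rw [indicator_of_mem (hmem u hu)]
    _ ≤ _ := lintegral_mono_set hsub

theorem arcIntegralOn_mono {ρ ρ' : ↥Sphere2 → ℝ≥0∞} (h : ∀ x, ρ x ≤ ρ' x) (f : ℝ → ↥Sphere2)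
    (a b : ℝ) : arcIntegralOn ρ f a b ≤ arcIntegralOn ρ' f a b :=
  lintegral_mono fun _ ↦ h _

/-- A curve which starts within distance `d` of `x` and leaves the ball of radius `2 * d` has
length at least `d` inside the ball of radius `3 * d`. -/
theorem le_arcIntegralOn_indicator_closedBall {f : ℝ → ↥Sphere2} {a b t₁ t₂ d : ℝ} {x : ↥Sphere2}
    (hf : ContinuousOn f (Icc a b)) (hvar : eVariationOn f (Icc a b) < ⊤) (h₁ : t₁ ∈ Icc a b)
    (h₂ : t₂ ∈ Icc a b) (hd : 0 < d) (hx₁ : dist (f t₁) x ≤ d) (hx₂ : 2 * d < dist (f t₂) x)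
    (m : ℝ≥0∞) :
    m ≤ arcIntegralOn ((closedBall x (3 * d)).indicator fun _ ↦ m / ENNReal.ofReal d) f a b := by
  have hfar : d ≤ dist (f t₂) (f t₁) := by linarith [dist_triangle (f t₂) (f t₁) x]
  obtain ⟨t₃, t₄, h₃, h₃₄, h₄, hD, hx₃⟩ : ∃ t₃ t₄, a ≤ t₃ ∧ t₃ ≤ t₄ ∧ t₄ ≤ b ∧
      d ≤ dist (f t₃) (f t₄) ∧ dist (f t₃) x ≤ 2 * d := by
    rcases le_total t₁ t₂ with h | h
    · exact ⟨t₁, t₂, h₁.1, h, h₂.2, by rwa [dist_comm], by linarith⟩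
    · have hsub : Icc t₂ t₁ ⊆ Icc a b := Icc_subset_Icc h₂.1 h₁.2
      obtain ⟨t₃, ht₃, heq⟩ := intermediate_value_Icc' h
        (f := fun t ↦ dist (f t) (f t₁))
        (fun t ht ↦ (hf.mono hsub t ht).dist continuousWithinAt_const) (show d ∈ Icc (dist (f t₁) (f t₁))
          (dist (f t₂) (f t₁)) from ⟨by simpa using hd.le, hfar⟩)
      simp only at heq
      exact ⟨t₃, t₁, (hsub ht₃).1, ht₃.2, h₁.2, heq.ge,
        by linarith [dist_triangle (f t₃) (f t₁) x]⟩
  refine le_trans ?_ ((le_arcIntegralOn_indicator_ball hf hvar h₃ h₃₄ h₄ hD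
    (m / ENNReal.ofReal d)).trans (arcIntegralOn_mono (fun y ↦ ?_) _ _ _))
  · rw [ENNReal.div_mul_cancel (ENNReal.ofReal_pos.2 hd).ne' ENNReal.ofReal_ne_top]
  · refine indicator_le_indicator_of_subset (fun z hz ↦ ?_) (fun _ ↦ zero_le) y
    rw [mem_ball] at hz
    rw [mem_closedBall]
    linarith [dist_triangle z (f t₃) x]

theorem sum_arcIntegralOn_le {ι : Type*} (F : Finset ι) (g : ι → ↥Sphere2 → ℝ≥0∞)
    (f : ℝ → ↥Sphere2) (a b : ℝ) :
    ∑ i ∈ F, arcIntegralOn (g i) f a b ≤ arcIntegralOn (fun y ↦ ∑ i ∈ F, g i y) f a b := by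
  classical
  induction F using Finset.induction_on with
  | empty => simp
  | insert i F hi ih =>
    simp only [Finset.sum_insert hi]
    exact (add_le_add_right ih _).trans (le_lintegral_add _ _)

theorem SpherePath.ordConnected (γ : SpherePath) : γ.I.OrdConnected := by
  obtain ⟨a, b, -, h | h | h | h⟩ := γ.hI <;> rw [h] <;> infer_instance

theorem SpherePath.nonempty (γ : SpherePath) : γ.I.Nonempty := by
  obtain ⟨a, b, hab, h | h | h | h⟩ := γ.hI <;> rw [h] <;> simp [hab, hab.le]

theorem SpherePath.sum_le_lineIntegral {γ : SpherePath} (hγ : γ.LocRectifiable) {ι : Type*}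
    (x : ι → ↥Sphere2) (d : ι → ℝ) (h : ι → ℝ≥0∞) (F : Finset ι) (hd : ∀ i, 0 < d i)
    (hF : ∀ i ∈ F, (∃ t ∈ γ.I, dist (γ.toFun t) (x i) ≤ d i) ∧
      ∃ t ∈ γ.I, 2 * d i < dist (γ.toFun t) (x i)) :
    ∑ i ∈ F, h i ≤ γ.lineIntegral fun y ↦ ∑' i, (closedBall (x i) (3 * d i)).indicator
      (fun _ ↦ h i / ENNReal.ofReal (d i)) y := by
  classical
  have hInt : ∃ a b, Icc a b ⊆ γ.I ∧ ∀ i ∈ F, (∃ t ∈ Icc a b, dist (γ.toFun t) (x i) ≤ d i) ∧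
      ∃ t ∈ Icc a b, 2 * d i < dist (γ.toFun t) (x i) := by
    have key : ∃ a ∈ γ.I, ∃ b ∈ γ.I, ∀ i ∈ F,
        (∃ t ∈ Icc a b, dist (γ.toFun t) (x i) ≤ d i) ∧
        ∃ t ∈ Icc a b, 2 * d i < dist (γ.toFun t) (x i) := by
      induction F using Finset.induction_on with
      | empty =>
        obtain ⟨t, ht⟩ := γ.nonempty
        exact ⟨t, ht, t, ht, by simp⟩
      | insert i F hi ih =>
        obtain ⟨a, ha, b, hb, hab⟩ := ih fun j hj ↦ hF j (Finset.mem_insert_of_mem hj)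
        obtain ⟨⟨t, ht, htd⟩, t', ht', htd'⟩ := hF i (Finset.mem_insert_self i F)
        have hmin : ∀ {r r' : ℝ}, r ∈ γ.I → r' ∈ γ.I → min r r' ∈ γ.I := fun {r r'} hr hr' ↦ by
          rcases min_choice r r' with h | h <;> rw [h] <;> assumption
        have hmax : ∀ {r r' : ℝ}, r ∈ γ.I → r' ∈ γ.I → max r r' ∈ γ.I := fun {r r'} hr hr' ↦ by
          rcases max_choice r r' with h | h <;> rw [h] <;> assumption
        refine ⟨min a (min t t'), hmin ha (hmin ht ht'), max b (max t t'),
          hmax hb (hmax ht ht'), fun j hj ↦ ?_⟩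
        rcases Finset.mem_insert.1 hj with rfl | hj
        · exact ⟨⟨t, by simp, htd⟩, t', by simp, htd'⟩
        · obtain ⟨⟨r, hr, hrd⟩, r', hr', hrd'⟩ := hab j hj
          have hsub : Icc a b ⊆ Icc (min a (min t t')) (max b (max t t')) :=
            Icc_subset_Icc (min_le_left _ _) (le_max_left _ _)
          exact ⟨⟨r, hsub hr, hrd⟩, r', hsub hr', hrd'⟩
    obtain ⟨a, ha, b, hb, hab⟩ := key
    exact ⟨a, b, γ.ordConnected.out ha hb, hab⟩
  obtain ⟨a, b, hab, hF⟩ := hInt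
  calc ∑ i ∈ F, h i ≤ ∑ i ∈ F, arcIntegralOn ((closedBall (x i) (3 * d i)).indicator
        fun _ ↦ h i / ENNReal.ofReal (d i)) γ.toFun a b := by
        refine Finset.sum_le_sum fun i hi ↦ ?_
        obtain ⟨⟨t, ht, htd⟩, t', ht', htd'⟩ := hF i hi
        exact le_arcIntegralOn_indicator_closedBall (γ.cont.mono hab) (hγ a b hab) ht ht' (hd i)
          htd htd' _
    _ ≤ _ := sum_arcIntegralOn_le F _ _ _ _
    _ ≤ _ := arcIntegralOn_mono (fun y ↦ ENNReal.sum_le_tsum F) _ _ _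
    _ ≤ _ := by
        refine le_iSup₂_of_le a b ?_
        rw [iSup_pos hab]

theorem SpherePath.finite_met_subset_closedBall (γ : SpherePath) {ι : Type*}
    {C : ι → Set ↥Sphere2} {x : ι → ↥Sphere2} {d : ι → ℝ}
    (hfin : ∀ δ : ℝ, 0 < δ → {i | δ ≤ d i}.Finite) (hpt : ∀ y, {i | y ∈ C i}.Finite) :
    {i | (γ.image ∩ C i).Nonempty ∧
      ∀ t ∈ γ.I, dist (γ.toFun t) (x i) ≤ 2 * d i}.Finite := by
  by_cases hconst : ∃ t ∈ γ.I, ∃ t' ∈ γ.I, γ.toFun t ≠ γ.toFun t'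
  · obtain ⟨t, ht, t', ht', hne⟩ := hconst
    have hpos := dist_pos.2 hne
    refine (hfin _ (div_pos hpos four_pos)).subset fun i hi ↦ ?_
    rw [mem_ofPred_eq]
    linarith [hi.2 t ht, hi.2 t' ht', dist_triangle_right (γ.toFun t) (γ.toFun t') (x i)]
  · push Not at hconst
    obtain ⟨t, ht⟩ := γ.nonempty
    refine (hpt (γ.toFun t)).subset fun i hi ↦ ?_
    obtain ⟨_, ⟨t', ht', rfl⟩, hC⟩ := hi.1
    rwa [mem_ofPred_eq, hconst t ht t' ht']

theorem SpherePath.tsum_met_ne_top {γ : SpherePath} (hγ : γ.LocRectifiable) {ι : Type*}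
    {C : ι → Set ↥Sphere2} {x : ι → ↥Sphere2} {d : ι → ℝ} {h : ι → ℝ≥0∞} (hd : ∀ i, 0 < d i)
    (hC : ∀ i, ∀ y ∈ C i, dist y (x i) ≤ d i)
    (hfin : ∀ δ : ℝ, 0 < δ → {i | δ ≤ d i}.Finite) (hpt : ∀ y, {i | y ∈ C i}.Finite)
    (hh : ∀ i, h i ≠ ⊤)
    (hInt : (γ.lineIntegral fun y ↦ ∑' i, (closedBall (x i) (3 * d i)).indicator
      (fun _ ↦ h i / ENNReal.ofReal (d i)) y) ≠ ⊤) :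
    ∑' i, {i | (γ.image ∩ C i).Nonempty}.indicator h i ≠ ⊤ := by
  classical
  set A := {i | (γ.image ∩ C i).Nonempty ∧ ∃ t ∈ γ.I, 2 * d i < dist (γ.toFun t) (x i)} with hA
  set B := {i | (γ.image ∩ C i).Nonempty ∧ ∀ t ∈ γ.I, dist (γ.toFun t) (x i) ≤ 2 * d i} with hB
  have hBfin : B.Finite := γ.finite_met_subset_closedBall hfin hpt
  have hle : ∀ i, {i | (γ.image ∩ C i).Nonempty}.indicator h i ≤
      A.indicator h i + B.indicator h i := fun i ↦ by
    by_cases hi : (γ.image ∩ C i).Nonempty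
    · rw [indicator_of_mem (by exact hi)]
      by_cases hf : ∃ t ∈ γ.I, 2 * d i < dist (γ.toFun t) (x i)
      · rw [indicator_of_mem (s := A) ⟨hi, hf⟩]
        exact le_self_add
      · push Not at hf
        rw [indicator_of_mem (s := B) ⟨hi, hf⟩]
        exact le_add_self
    · rw [indicator_of_notMem (by exact hi)]
      exact zero_le
  refine ne_top_of_le_ne_top ?_ (ENNReal.tsum_le_tsum hle)
  rw [ENNReal.tsum_add, ENNReal.add_ne_top]
  constructor
  · refine ne_top_of_le_ne_top hInt ?_
    rw [ENNReal.tsum_eq_iSup_sum]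
    refine iSup_le fun F ↦ ?_
    rw [Finset.sum_indicator_eq_sum_filter]
    refine SpherePath.sum_le_lineIntegral hγ x d h _ hd fun i hi ↦ ?_
    obtain ⟨⟨_, ⟨t, ht, rfl⟩, hti⟩, hfar⟩ := (Finset.mem_filter.1 hi).2
    exact ⟨⟨t, ht, hC i _ hti⟩, hfar⟩
  · rw [tsum_eq_sum (s := hBfin.toFinset) fun i hi ↦ indicator_of_notMem (by simpa using hi) _]
    refine ENNReal.sum_ne_top.2 fun i _ ↦ ne_top_of_le_ne_top (hh i) (indicator_le_self _ _ _)

theorem pathMassSum_eq_tsum_indicator (S : Set ↥Sphere2) (ρ : Set ↥Sphere2 → ℝ≥0∞)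
    (γ : SpherePath) :
    pathMassSum S ρ γ = ∑' C : {C // IsPeripheralCircle S C},
      {C : {C // IsPeripheralCircle S C} | (γ.image ∩ C.1).Nonempty}.indicator
        (fun C ↦ ρ C.1) C := by
  rw [← tsum_subtype {C : {C // IsPeripheralCircle S C} | (γ.image ∩ C.1).Nonempty}
    (fun C ↦ ρ C.1)]
  exact ((Equiv.subtypeSubtypeEquivSubtypeInter (IsPeripheralCircle S)
    fun C ↦ (γ.image ∩ C).Nonempty).tsum_eq fun C ↦ ρ C.1).symm

/-! ### Path families of conformal modulus zero -/

theorem conformalModulus_le {Γ : Set SpherePath} {ρ : ↥Sphere2 → ℝ≥0∞} (hρ : Measurable ρ)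
    (h : ∀ γ ∈ Γ, γ.LocRectifiable → 1 ≤ γ.lineIntegral ρ) :
    conformalModulus Γ ≤ ∫⁻ x, ρ x ^ 2 ∂sphereMeasure :=
  iInf_le_of_le ρ (iInf₂_le hρ h)

theorem conformalModulus_mono {Γ Γ' : Set SpherePath} (h : Γ ⊆ Γ') :
    conformalModulus Γ ≤ conformalModulus Γ' :=
  le_iInf fun _ ↦ le_iInf₂ fun hρ hadm ↦ conformalModulus_le hρ fun γ hγ ↦ hadm γ (h hγ)

theorem SpherePath.lineIntegral_mono (γ : SpherePath) {ρ ρ' : ↥Sphere2 → ℝ≥0∞}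
    (h : ∀ x, ρ x ≤ ρ' x) : γ.lineIntegral ρ ≤ γ.lineIntegral ρ' :=
  iSup₂_mono fun _ _ ↦ iSup_mono fun _ ↦ arcIntegralOn_mono h _ _ _

theorem SpherePath.mul_lineIntegral (γ : SpherePath) {ρ : ↥Sphere2 → ℝ≥0∞} {c : ℝ≥0∞}
    (hc : c ≠ ⊤) : c * γ.lineIntegral ρ = γ.lineIntegral fun x ↦ c * ρ x := by
  simp only [SpherePath.lineIntegral, arcIntegralOn, ENNReal.mul_iSup, lintegral_const_mul' c _ hc]

theorem conformalModulus_iUnion_eq_zero {Γ : ℕ → Set SpherePath}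
    (h : ∀ n, conformalModulus (Γ n) = 0) : conformalModulus (⋃ n, Γ n) = 0 := by
  refine le_antisymm (ENNReal.le_of_forall_pos_le_add fun ε hε _ ↦ ?_) zero_le
  obtain ⟨δ, hδ, hsum⟩ := ENNReal.exists_pos_sum_of_countable (ENNReal.coe_pos.2 hε).ne' ℕ
  have hex : ∀ n, ∃ ρ : ↥Sphere2 → ℝ≥0∞, Measurable ρ ∧
      (∀ γ ∈ Γ n, γ.LocRectifiable → 1 ≤ γ.lineIntegral ρ) ∧
      ∫⁻ x, ρ x ^ 2 ∂sphereMeasure < δ n := fun n ↦ by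
    have hlt : conformalModulus (Γ n) < δ n := by
      rw [h n]
      exact ENNReal.coe_pos.2 (hδ n)
    simp only [conformalModulus, iInf_lt_iff] at hlt
    obtain ⟨ρ, hρ, hadm, hlt⟩ := hlt
    exact ⟨ρ, hρ, hadm, hlt⟩
  choose ρ hρ hadm hlt using hex
  refine (conformalModulus_le (ρ := fun x ↦ ⨆ n, ρ n x) (Measurable.iSup hρ) ?_).trans ?_
  · intro γ hγ hrect
    obtain ⟨n, hn⟩ := mem_iUnion.1 hγ
    exact (hadm n γ hn hrect).trans (γ.lineIntegral_mono fun x ↦ le_iSup (fun n ↦ ρ n x) n)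
  · calc ∫⁻ x, (⨆ n, ρ n x) ^ 2 ∂sphereMeasure
        ≤ ∫⁻ x, ∑' n, ρ n x ^ 2 ∂sphereMeasure := by
          refine lintegral_mono fun x ↦ ?_
          rw [ENNReal.iSup_pow_of_ne_zero two_ne_zero]
          exact iSup_le fun n ↦ ENNReal.le_tsum n
      _ = ∑' n, ∫⁻ x, ρ n x ^ 2 ∂sphereMeasure :=
          lintegral_tsum fun n ↦ ((hρ n).pow_const 2).aemeasurable
      _ ≤ ∑' n, (δ n : ℝ≥0∞) := ENNReal.tsum_le_tsum fun n ↦ (hlt n).le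
      _ ≤ 0 + ε := by simpa using hsum.le

theorem conformalModulus_union_eq_zero {Γ Γ' : Set SpherePath} (h : conformalModulus Γ = 0)
    (h' : conformalModulus Γ' = 0) : conformalModulus (Γ ∪ Γ') = 0 := by
  rw [← le_zero_iff, ← conformalModulus_iUnion_eq_zero
    (Γ := fun n ↦ if n = 0 then Γ else Γ') fun n ↦ by split_ifs <;> assumption]
  refine conformalModulus_mono (union_subset ?_ ?_)
  · exact subset_iUnion_of_subset 0 (by simp)
  · exact subset_iUnion_of_subset 1 (by simp)

theorem conformalModulus_not_locRectifiable :
    conformalModulus {γ | ¬ γ.LocRectifiable} = 0 :=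
  le_antisymm ((conformalModulus_le measurable_const fun _ hγ h ↦ (hγ h).elim).trans_eq
    (by simp : ∫⁻ _, (0 : ℝ≥0∞) ^ 2 ∂sphereMeasure = 0)) zero_le

theorem conformalModulus_lineIntegral_eq_top {ρ : ↥Sphere2 → ℝ≥0∞} (hρ : Measurable ρ)
    (hfin : ∫⁻ x, ρ x ^ 2 ∂sphereMeasure ≠ ⊤) :
    conformalModulus {γ | γ.lineIntegral ρ = ⊤} = 0 := by
  refine le_antisymm (ENNReal.le_of_forall_pos_le_add fun ε hε _ ↦ ?_) zero_le
  obtain ⟨c, hc, hlt⟩ := ENNReal.exists_nnreal_pos_mul_lt hfin (ENNReal.coe_pos.2 hε).ne'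
  refine (conformalModulus_le (ρ := fun x ↦ (min c 1 : NNReal) * ρ x)
    (hρ.const_mul _) fun γ hγ _ ↦ ?_).trans ?_
  · rw [← γ.mul_lineIntegral ENNReal.coe_ne_top, (hγ : γ.lineIntegral ρ = ⊤),
      ENNReal.mul_top (by simpa using hc.ne')]
    exact le_top
  · simp only [mul_pow]
    rw [lintegral_const_mul' _ _ (by simp), zero_add]
    refine le_trans ?_ hlt.le
    gcongr
    calc ((min c 1 : NNReal) : ℝ≥0∞) ^ 2 ≤ ((min c 1 : NNReal) : ℝ≥0∞) ^ 1 :=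
          pow_le_pow_right_of_le_one' (by exact_mod_cast min_le_right c 1) one_le_two
      _ ≤ c := by simp

/-! ### Admissible mass distributions -/

theorem exists_exceptional_family {S : Set ↥Sphere2}
    (hq : UniformQuasicircles {C | IsPeripheralCircle S C}) {ρ : Set ↥Sphere2 → ℝ≥0∞}
    (hρ : carpetMass S ρ ≠ ⊤) :
    ∃ Γ₀ : Set SpherePath, conformalModulus Γ₀ = 0 ∧ ∀ γ ∉ Γ₀, pathMassSum S ρ γ ≠ ⊤ := by
  obtain ⟨x, M, hcount, hM, hC, hfin, hpt, hInt⟩ := exists_peripheral_geometry hq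
  have hne : ∀ C : {C // IsPeripheralCircle S C}, ρ C.1 ≠ ⊤ := fun C h ↦
    ENNReal.ne_top_of_tsum_ne_top hρ C (by simp [h])
  refine ⟨{γ | ¬ γ.LocRectifiable} ∪
    {γ | γ.lineIntegral (fun y ↦ ∑' C : {C // IsPeripheralCircle S C},
      (closedBall (x C) (3 * diam C.1)).indicator
        (fun _ ↦ ρ C.1 / ENNReal.ofReal (diam C.1)) y) = ⊤},
    conformalModulus_union_eq_zero conformalModulus_not_locRectifiable
      (conformalModulus_lineIntegral_eq_top (Measurable.tsum fun C ↦
        measurable_const.indicator measurableSet_closedBall) ?_), fun γ hγ ↦ ?_⟩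
  · exact ne_top_of_le_ne_top (ENNReal.mul_ne_top hM hρ) (hInt (fun C ↦ ρ C.1) hne)
  · simp only [mem_union, mem_ofPred_eq, not_or, not_not] at hγ
    rw [pathMassSum_eq_tsum_indicator]
    exact SpherePath.tsum_met_ne_top hγ.1 (fun C ↦ (hC C).1) (fun C ↦ (hC C).2) hfin hpt hne hγ.2

theorem pathMassSum_mono {S : Set ↥Sphere2} {ρ ρ' : Set ↥Sphere2 → ℝ≥0∞}
    (h : ∀ C, IsPeripheralCircle S C → ρ C ≤ ρ' C) (γ : SpherePath) :
    pathMassSum S ρ γ ≤ pathMassSum S ρ' γ :=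
  ENNReal.tsum_le_tsum fun C ↦ h C.1 C.2.1

theorem CarpetAdmissible.mono {S : Set ↥Sphere2} {Γ : Set SpherePath}
    {ρ ρ' : Set ↥Sphere2 → ℝ≥0∞} (hρ : CarpetAdmissible S Γ ρ)
    (h : ∀ C, IsPeripheralCircle S C → ρ C ≤ ρ' C) : CarpetAdmissible S Γ ρ' :=
  let ⟨Γ₀, hsub, hzero, hadm⟩ := hρ
  ⟨Γ₀, hsub, hzero, fun γ hγ ↦ (hadm γ hγ).trans (pathMassSum_mono h γ)⟩

theorem pathMassSum_add (S : Set ↥Sphere2) (ρ ρ' : Set ↥Sphere2 → ℝ≥0∞) (γ : SpherePath) :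
    pathMassSum S (fun C ↦ ρ C + ρ' C) γ = pathMassSum S ρ γ + pathMassSum S ρ' γ :=
  ENNReal.tsum_add

theorem pathMassSum_const_mul (S : Set ↥Sphere2) (c : ℝ≥0∞) (ρ : Set ↥Sphere2 → ℝ≥0∞)
    (γ : SpherePath) : pathMassSum S (fun C ↦ c * ρ C) γ = c * pathMassSum S ρ γ :=
  ENNReal.tsum_mul_left

theorem CarpetAdmissible.convex_combination {S : Set ↥Sphere2} {Γ : Set SpherePath}
    {ρ ρ' : Set ↥Sphere2 → ℝ≥0∞} (hρ : CarpetAdmissible S Γ ρ) (hρ' : CarpetAdmissible S Γ ρ')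
    {a b : ℝ≥0∞} (hab : a + b = 1) : CarpetAdmissible S Γ fun C ↦ a * ρ C + b * ρ' C := by
  obtain ⟨Γ₀, hsub, hzero, hadm⟩ := hρ
  obtain ⟨Γ₁, hsub', hzero', hadm'⟩ := hρ'
  refine ⟨Γ₀ ∪ Γ₁, union_subset hsub hsub', conformalModulus_union_eq_zero hzero hzero',
    fun γ hγ ↦ ?_⟩
  simp only [Set.mem_sdiff, mem_union, not_or] at hγ
  rw [pathMassSum_add, pathMassSum_const_mul, pathMassSum_const_mul, ← hab]
  exact add_le_add (le_mul_of_one_le_right' (hadm γ ⟨hγ.1, hγ.2.1⟩))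
    (le_mul_of_one_le_right' (hadm' γ ⟨hγ.1, hγ.2.2⟩))

theorem carpetAdmissible_of_approx {S : Set ↥Sphere2}
    (hq : UniformQuasicircles {C | IsPeripheralCircle S C}) {Γ : Set SpherePath}
    {ρ : Set ↥Sphere2 → ℝ≥0∞} {ρ' h : ℕ → Set ↥Sphere2 → ℝ≥0∞}
    (hadm : ∀ n, CarpetAdmissible S Γ (ρ' n))
    (hle : ∀ n C, IsPeripheralCircle S C → ρ' n C ≤ ρ C + h n C)
    (hh : ∀ n, carpetMass S (h n) ≤ (8⁻¹ : ℝ≥0∞) ^ n) : CarpetAdmissible S Γ ρ := by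
  set H : Set ↥Sphere2 → ℝ≥0∞ := fun C ↦ ⨆ n, 2 ^ n * h n C with hH
  have hHmass : carpetMass S H ≠ ⊤ := by
    refine ne_top_of_le_ne_top (b := ∑' n : ℕ, (2⁻¹ : ℝ≥0∞) ^ n) ?_ ?_
    · rw [ENNReal.tsum_geometric]
      simp
    · calc carpetMass S H ≤ ∑' C : {C // IsPeripheralCircle S C}, ∑' n, 4 ^ n * h n C ^ 2 := by
            refine ENNReal.tsum_le_tsum fun C ↦ ?_
            rw [hH]
            simp only [ENNReal.iSup_pow_of_ne_zero two_ne_zero, mul_pow]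
            refine iSup_le fun n ↦ le_trans (le_of_eq ?_) (ENNReal.le_tsum n)
            rw [← pow_mul, mul_comm n, pow_mul]
            norm_num
        _ = ∑' n, 4 ^ n * carpetMass S (h n) := by
            rw [ENNReal.tsum_comm]
            simp only [ENNReal.tsum_mul_left, carpetMass]
        _ ≤ ∑' n : ℕ, (2⁻¹ : ℝ≥0∞) ^ n := by
            refine ENNReal.tsum_le_tsum fun n ↦ (mul_le_mul_right (hh n) _).trans_eq ?_
            rw [← mul_pow]
            congr 1
            rw [show (8 : ℝ≥0∞) = 4 * 2 by norm_num, ENNReal.mul_inv (by simp) (by simp),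
              ← mul_assoc, ENNReal.mul_inv_cancel (by simp) (by simp), one_mul]
  have hhH : ∀ n C, h n C ≤ (2⁻¹ : ℝ≥0∞) ^ n * H C := fun n C ↦ by
    calc h n C = (2⁻¹ : ℝ≥0∞) ^ n * (2 ^ n * h n C) := by
          rw [← mul_assoc, ← mul_pow, ENNReal.inv_mul_cancel (by simp) (by simp), one_pow, one_mul]
      _ ≤ _ := by
          gcongr
          exact le_iSup (fun n ↦ 2 ^ n * h n C) n
  obtain ⟨Γ', hΓ', hfin⟩ := exists_exceptional_family hq hHmass
  choose Γ₀ hsub hzero hadm using hadm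
  refine ⟨((⋃ n, Γ₀ n) ∪ Γ') ∩ Γ, inter_subset_right, le_antisymm ((conformalModulus_mono
    inter_subset_left).trans_eq (conformalModulus_union_eq_zero
      (conformalModulus_iUnion_eq_zero hzero) hΓ')) zero_le, fun γ hγ ↦ ?_⟩
  have hγΓ := hγ.1
  have hγ' : γ ∉ (⋃ n, Γ₀ n) ∪ Γ' := fun h ↦ hγ.2 ⟨h, hγ.1⟩
  simp only [mem_union, mem_iUnion, not_or, not_exists] at hγ'
  have hbound : ∀ n : ℕ, 1 ≤ pathMassSum S ρ γ + (2⁻¹ : ℝ≥0∞) ^ n * pathMassSum S H γ := fun n ↦ by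
    rw [← pathMassSum_const_mul, ← pathMassSum_add]
    exact (hadm n γ ⟨hγΓ, hγ'.1 n⟩).trans
      (pathMassSum_mono (fun C hC ↦ (hle n C hC).trans (add_le_add_right (hhH n C) _)) γ)
  have hlim : Tendsto (fun n : ℕ ↦ pathMassSum S ρ γ + (2⁻¹ : ℝ≥0∞) ^ n * pathMassSum S H γ) atTop
      (𝓝 (pathMassSum S ρ γ + 0 * pathMassSum S H γ)) :=
    tendsto_const_nhds.add (ENNReal.Tendsto.mul_const
      (ENNReal.tendsto_pow_atTop_nhds_zero_of_lt_one (by simp)) (Or.inr (hfin γ hγ'.2)))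
  rw [zero_mul, add_zero] at hlim
  exact ge_of_tendsto' hlim hbound

/-! ### The extremal mass distribution -/

theorem tsum_ofReal_sq_eq_ofReal_norm_sq {ι : Type*} (f : lp (fun _ : ι ↦ ℝ) 2) :
    ∑' i, ENNReal.ofReal |f i| ^ 2 = ENNReal.ofReal (‖f‖ ^ 2) := by
  have htwo : (0 : ℝ) < (2 : ℝ≥0∞).toReal := by simp
  have hsum := (lp.memℓp f).summable htwo
  have hnorm := lp.norm_rpow_eq_tsum htwo f
  simp only [ENNReal.toReal_ofNat, Real.rpow_two, Real.norm_eq_abs] at hsum hnorm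
  rw [hnorm, ENNReal.ofReal_tsum_of_nonneg (fun _ ↦ sq_nonneg _) hsum]
  simp only [ENNReal.ofReal_pow (abs_nonneg _)]

/-- The nonnegative square-summable mass distributions on the peripheral circles of `S` which are
admissible for `Γ`. -/
def admissibleSet (S : Set ↥Sphere2) (Γ : Set SpherePath) :
    Set (lp (fun _ : {C // IsPeripheralCircle S C} ↦ ℝ) 2) :=
  {f | (∀ C, 0 ≤ f C) ∧
    CarpetAdmissible S Γ (Function.extend Subtype.val (fun C ↦ ENNReal.ofReal (f C)) 0)}

theorem extend_val_apply {S C : Set ↥Sphere2} (hC : IsPeripheralCircle S C)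
    (r : {C // IsPeripheralCircle S C} → ℝ≥0∞) :
    Function.extend Subtype.val r 0 C = r ⟨C, hC⟩ :=
  Subtype.val_injective.extend_apply r 0 ⟨C, hC⟩

theorem carpetMass_extend (S : Set ↥Sphere2) (r : {C // IsPeripheralCircle S C} → ℝ≥0∞) :
    carpetMass S (Function.extend Subtype.val r 0) = ∑' C, r C ^ 2 :=
  tsum_congr fun C ↦ by rw [extend_val_apply C.2]

theorem convex_admissibleSet (S : Set ↥Sphere2) (Γ : Set SpherePath) :
    Convex ℝ (admissibleSet S Γ) := by
  intro f hf g hg a b ha hb hab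
  refine ⟨fun C ↦ add_nonneg (mul_nonneg ha (hf.1 C)) (mul_nonneg hb (hg.1 C)), ?_⟩
  refine (hf.2.convex_combination hg.2 (a := ENNReal.ofReal a) (b := ENNReal.ofReal b)
    (by rw [← ENNReal.ofReal_add ha hb, hab, ENNReal.ofReal_one])).mono fun C hC ↦ ?_
  rw [extend_val_apply hC, extend_val_apply hC, extend_val_apply hC, ← ENNReal.ofReal_mul ha,
    ← ENNReal.ofReal_mul hb, ← ENNReal.ofReal_add (mul_nonneg ha (hf.1 _))
      (mul_nonneg hb (hg.1 _))]
  rfl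

theorem isClosed_admissibleSet {S : Set ↥Sphere2}
    (hq : UniformQuasicircles {C | IsPeripheralCircle S C}) (Γ : Set SpherePath) :
    IsClosed (admissibleSet S Γ) := by
  refine isClosed_of_closure_subset fun f hf ↦ ?_
  have happrox : ∀ n : ℕ, ∃ g ∈ admissibleSet S Γ, ‖g - f‖ ^ 2 ≤ (8⁻¹ : ℝ) ^ n := fun n ↦ by
    obtain ⟨g, hg, hlt⟩ := Metric.mem_closure_iff.1 hf (√((8⁻¹ : ℝ) ^ n)) (by positivity)
    refine ⟨g, hg, ?_⟩
    rw [dist_comm, dist_eq_norm] at hlt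
    exact (Real.lt_sqrt (norm_nonneg _)).1 hlt |>.le
  constructor
  · intro C
    by_contra! hneg
    obtain ⟨g, hg, hlt⟩ := Metric.mem_closure_iff.1 hf (-f C) (by linarith)
    rw [dist_comm, dist_eq_norm] at hlt
    have hC := lp.norm_apply_le_norm two_ne_zero (g - f) C
    rw [lp.coeFn_sub, Pi.sub_apply, Real.norm_eq_abs] at hC
    linarith [le_abs_self (g C - f C), hg.1 C]
  · choose g hg hgf using happrox
    refine carpetAdmissible_of_approx hq (fun n ↦ (hg n).2)
      (h := fun n ↦ Function.extend Subtype.val (fun C ↦ ENNReal.ofReal |(g n - f) C|) 0)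
      (fun n C hC ↦ ?_) fun n ↦ ?_
    · rw [extend_val_apply hC, extend_val_apply hC, extend_val_apply hC]
      refine le_trans (ENNReal.ofReal_le_ofReal ?_) ENNReal.ofReal_add_le
      rw [lp.coeFn_sub, Pi.sub_apply]
      linarith [le_abs_self (g n ⟨C, hC⟩ - f ⟨C, hC⟩)]
    · rw [carpetMass_extend, tsum_ofReal_sq_eq_ofReal_norm_sq]
      refine (ENNReal.ofReal_le_ofReal (hgf n)).trans_eq ?_
      rw [ENNReal.ofReal_pow (by positivity), ENNReal.ofReal_inv_of_pos (by positivity)]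
      norm_num

theorem exists_mem_admissibleSet {S : Set ↥Sphere2} {Γ : Set SpherePath}
    {ρ : Set ↥Sphere2 → ℝ≥0∞} (hρ : CarpetAdmissible S Γ ρ) (hmass : carpetMass S ρ ≠ ⊤) :
    ∃ f ∈ admissibleSet S Γ, carpetMass S ρ = ENNReal.ofReal (‖f‖ ^ 2) := by
  have hne : ∀ C : {C // IsPeripheralCircle S C}, ρ C.1 ≠ ⊤ := fun C h ↦
    ENNReal.ne_top_of_tsum_ne_top hmass C (by simp [h])
  have hmem : Memℓp (fun C : {C // IsPeripheralCircle S C} ↦ (ρ C.1).toReal) 2 := by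
    refine memℓp_gen ?_
    simpa using ENNReal.summable_toReal hmass
  refine ⟨⟨_, hmem⟩, ⟨fun C ↦ ENNReal.toReal_nonneg, hρ.mono fun C hC ↦ ?_⟩, ?_⟩
  · rw [extend_val_apply hC]
    exact (ENNReal.ofReal_toReal (hne ⟨C, hC⟩)).ge
  · rw [← tsum_ofReal_sq_eq_ofReal_norm_sq]
    refine tsum_congr fun C ↦ ?_
    simp only [abs_of_nonneg ENNReal.toReal_nonneg, ENNReal.ofReal_toReal (hne C)]

/-- **Existence of an extremal mass distribution for carpet modulus** (Proposition 2.4).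
If `S` is a carpet in `S²` whose peripheral circles are uniform quasicircles and `Γ` is a
path family in `S²` with `mod_S(Γ) < ∞`, then the infimum in the definition of `mod_S(Γ)`
is attained: there is an admissible mass distribution `ρ` whose total mass equals
`mod_S(Γ)`. -/
theorem extremal_mass_distribution_exists (S : Set ↥Sphere2)
    (hS : IsCarpet S) (hq : UniformQuasicircles {C | IsPeripheralCircle S C})
    (Γ : Set SpherePath) (h : carpetModulus S Γ < ⊤) :
    ∃ ρ : Set ↥Sphere2 → ℝ≥0∞, CarpetAdmissible S Γ ρ ∧
      carpetMass S ρ = carpetModulus S Γ := by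
  have hnonempty : (admissibleSet S Γ).Nonempty := by
    simp only [carpetModulus, iInf_lt_iff] at h
    obtain ⟨ρ, hρ, hlt⟩ := h
    obtain ⟨f, hf, -⟩ := exists_mem_admissibleSet hρ hlt.ne
    exact ⟨f, hf⟩
  obtain ⟨f, hf, hmin⟩ := exists_norm_eq_iInf_of_complete_convex hnonempty
    (isClosed_admissibleSet hq Γ).isComplete (convex_admissibleSet S Γ) 0
  refine ⟨_, hf.2, le_antisymm (le_iInf₂ fun ρ hρ ↦ ?_) (iInf₂_le _ hf.2)⟩
  by_cases hmass : carpetMass S ρ = ⊤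
  · rw [hmass]
    exact le_top
  obtain ⟨g, hg, hgmass⟩ := exists_mem_admissibleSet hρ hmass
  have hle : ‖f‖ ≤ ‖g‖ := by
    have hbdd : BddBelow (range fun w : admissibleSet S Γ ↦ ‖0 - w.1‖) :=
      ⟨0, by rintro _ ⟨w, rfl⟩; exact norm_nonneg _⟩
    simpa using hmin.trans_le (ciInf_le hbdd ⟨g, hg⟩)
  rw [carpetMass_extend, hgmass]
  calc ∑' C, ENNReal.ofReal (f C) ^ 2 = ∑' C, ENNReal.ofReal |f C| ^ 2 :=
        tsum_congr fun C ↦ by rw [abs_of_nonneg (hf.1 C)]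
    _ = ENNReal.ofReal (‖f‖ ^ 2) := tsum_ofReal_sq_eq_ofReal_norm_sq f
    _ ≤ ENNReal.ofReal (‖g‖ ^ 2) := ENNReal.ofReal_le_ofReal (by gcongr)
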